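/- arXiv:2402.18693 — 6 statements merged into one kernel-verified Lean document; each statement's English description precedes it below -/
import Mathlib

section
/- Let k be a field, R = k[x_1,…,x_n] the standard-graded polynomial ring, and a_1,…,a_m nonzero proper homogeneous ideals of R satisfying α(a_{t+1}) = α(a_1) + t for all 0 ≤ t ≤ m−1 (property (P2)). Fix 1 ≤ t < m and for s ≥ 1 let b_{t,s} := ∑ over all tuples (c_1,…,c_{m−t+1}) of non-negative integers with ∑_{i=1}^{m−t+1} i·c_i = s of the product ideal a_t^{c_1} a_{t+1}^{c_2} ⋯ a_m^{c_{m−t+1}}. Then for every non-negative integer k and every 1 ≤ l ≤ m−t+1, α(b_{t, k(m−t+1)+l}) = k(α(a_1)+m−1) + α(a_1) + t − 2 + l. (Under property (P1), i.e. when the symbolic Rees algebra of a_t equals R[a_t T, a_{t+1} T^2, …, a_m T^{m−t+1}], one has a_t^{(s)} = b_{t,s}, so this computes α of every symbolic power of a_t.) -/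
open MvPolynomial

attribute [local instance] MvPolynomial.gradedAlgebra

/-- The least degree of a nonzero homogeneous element of an ideal of a polynomial ring. -/
noncomputable def alphaDeg {σ K : Type*} [CommSemiring K] (I : Ideal (MvPolynomial σ K)) : ℕ :=
  sInf {d | ∃ f ∈ I, f ≠ 0 ∧ MvPolynomial.IsHomogeneous f d}

/-- `bFam a t m s` is the sum, over all tuples `(c_1, …, c_{m-t+1})` of non-negative integers
with `∑_{i=1}^{m-t+1} i * c_i = s`, of the product ideal
`a_t ^ c_1 * a_{t+1} ^ c_2 * ⋯ * a_m ^ c_{m-t+1}`. -/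
noncomputable def bFam {R : Type*} [CommRing R] (a : ℕ → Ideal R) (t m s : ℕ) : Ideal R :=
  ⨆ c : {c : Fin (m - t + 1) → ℕ // ∑ i, (i.1 + 1) * c i = s},
    ∏ i : Fin (m - t + 1), a (t + i.1) ^ c.1 i

lemma alpha_exists {n : ℕ} {K : Type*} [Field K] (I : Ideal (MvPolynomial (Fin n) K))
    (h0 : I ≠ ⊥) (hh : Ideal.IsHomogeneous (homogeneousSubmodule (Fin n) K) I) :
    ∃ f ∈ I, f ≠ 0 ∧ MvPolynomial.IsHomogeneous f (alphaDeg I) := by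
  have key : Set.Nonempty {d | ∃ f ∈ I, f ≠ 0 ∧ MvPolynomial.IsHomogeneous f d} := by
    obtain ⟨f, hf, hf0⟩ := Submodule.exists_mem_ne_zero_of_ne_bot h0
    by_contra hc
    apply hf0
    rw [← sum_homogeneousComponent f]
    apply Finset.sum_eq_zero
    intro i _
    by_contra hi
    apply hc
    refine ⟨i, homogeneousComponent i f, ?_, hi, homogeneousComponent_isHomogeneous i f⟩
    have := hh i hf
    rw [← MvPolynomial.decomposition.decompose'_apply]
    exact this
  exact Nat.sInf_mem key

lemma alpha_le_pow {n : ℕ} {K : Type*} [Field K] (I : Ideal (MvPolynomial (Fin n) K))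
    (hh : Ideal.IsHomogeneous (homogeneousSubmodule (Fin n) K) I) :
    I ≤ idealOfVars (Fin n) K ^ alphaDeg I := by
  intro f hf
  rw [mem_pow_idealOfVars_iff]
  intro x hx
  apply Nat.sInf_le
  refine ⟨homogeneousComponent x.degree f, ?_, ?_, homogeneousComponent_isHomogeneous _ f⟩
  · have := hh x.degree hf
    rw [← MvPolynomial.decomposition.decompose'_apply]
    exact this
  · intro h
    have h2 := congrArg (coeff x) h
    rw [coeff_homogeneousComponent] at h2
    simp at h2
    exact (mem_support_iff.mp hx) h2

lemma le_of_mem_pow {n : ℕ} {K : Type*} [Field K] {f : MvPolynomial (Fin n) K} {d e : ℕ}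
    (h0 : f ≠ 0) (hf : IsHomogeneous f d) (hm : f ∈ idealOfVars (Fin n) K ^ e) : e ≤ d := by
  rw [mem_pow_idealOfVars_iff] at hm
  obtain ⟨x, hx⟩ := MvPolynomial.support_nonempty.mpr h0
  have h1 := hm x hx
  have h2 := hf (mem_support_iff.mp hx)
  rw [Finsupp.degree_eq_weight_one] at h1
  exact h1.trans h2.le

theorem alpha_of_symbolic_family {n : ℕ} {K : Type*} [Field K] (m : ℕ)
    (a : ℕ → Ideal (MvPolynomial (Fin n) K))
    (hne : ∀ i, 1 ≤ i → i ≤ m → a i ≠ ⊥)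
    (hproper : ∀ i, 1 ≤ i → i ≤ m → a i ≠ ⊤)
    (hhom : ∀ i, 1 ≤ i → i ≤ m →
      Ideal.IsHomogeneous (homogeneousSubmodule (Fin n) K) (a i))
    (hP2 : ∀ t, t ≤ m - 1 → alphaDeg (a (t + 1)) = alphaDeg (a 1) + t)
    (t : ℕ) (ht1 : 1 ≤ t) (htm : t < m)
    (k l : ℕ) (hl1 : 1 ≤ l) (hl : l ≤ m - t + 1) :
    (alphaDeg (bFam a t m (k * (m - t + 1) + l)) : ℤ)
      = k * ((alphaDeg (a 1) : ℤ) + m - 1) + alphaDeg (a 1) + t - 2 + l := by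
  have hA : 1 ≤ alphaDeg (a 1) := by
    by_contra hc
    obtain ⟨f, hf, h0, hd⟩ := alpha_exists (a 1) (hne 1 le_rfl (by omega)) (hhom 1 le_rfl (by omega))
    have hz : alphaDeg (a 1) = 0 := by omega
    rw [hz] at hd
    have hC : f = C (coeff 0 f) :=
      (totalDegree_eq_zero_iff_eq_C).mp (Nat.le_zero.mp hd.totalDegree_le)
    apply hproper 1 le_rfl (by omega)
    apply Ideal.eq_top_of_isUnit_mem _ hf
    rw [hC]
    apply IsUnit.map
    rw [isUnit_iff_ne_zero]
    intro h
    rw [h] at hC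
    simp at hC
    exact h0 hC
  obtain ⟨q, hq⟩ : ∃ q, alphaDeg (a 1) + t = q + 2 := ⟨alphaDeg (a 1) + t - 2, by omega⟩
  obtain ⟨N, hN⟩ : ∃ N, N = m - t := ⟨_, rfl⟩
  have hal : ∀ i, i ≤ N → alphaDeg (a (t + i)) = q + (i + 1) := by
    intro i hi
    have := hP2 (t + i - 1) (by omega)
    rw [show t + i - 1 + 1 = t + i by omega] at this
    omega
  have main : alphaDeg (bFam a t m (k * (m - t + 1) + l))
      = (k * (N + 1) + l) + q * (k + 1) := by
    rw [← hN] at hl ⊢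
    have hmem : ∃ f ∈ bFam a t m (k * (N + 1) + l), f ≠ 0 ∧
        IsHomogeneous f ((k * (N + 1) + l) + q * (k + 1)) := by
      obtain ⟨f, hf, hf0, hfd⟩ := alpha_exists (a (t + N)) (hne _ (by omega) (by omega))
        (hhom _ (by omega) (by omega))
      obtain ⟨g, hg, hg0, hgd⟩ := alpha_exists (a (t + (l - 1))) (hne _ (by omega) (by omega))
        (hhom _ (by omega) (by omega))
      rw [hal _ (by omega)] at hfd hgd
      refine ⟨f ^ k * g, ?_, mul_ne_zero (pow_ne_zero _ hf0) hg0, ?_⟩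
      · unfold bFam
        subst hN
        let u : Fin (m - t + 1) := ⟨m - t, by omega⟩
        let v : Fin (m - t + 1) := ⟨l - 1, by omega⟩
        refine Ideal.mem_iSup_of_mem ⟨Pi.single u k + Pi.single v 1, ?hs⟩ ?hm
        case hs =>
          simp only [Pi.add_apply, mul_add, Finset.sum_add_distrib]
          simp [Pi.single_apply, u, v]
          rw [Nat.sub_add_cancel hl1]; ring
        case hm =>
          simp only [Pi.add_apply, pow_add, Finset.prod_mul_distrib]
          have e1 : ∏ i, a (t + i.1) ^ (Pi.single u k : Fin (m - t + 1) → ℕ) i = a (t + (m - t)) ^ k := by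
            rw [Finset.prod_eq_single u] <;> simp +contextual [u, Pi.single_apply]
          have e2 : ∏ i, a (t + i.1) ^ (Pi.single v 1 : Fin (m - t + 1) → ℕ) i = a (t + (l - 1)) := by
            rw [Finset.prod_eq_single v] <;> simp +contextual [v, Pi.single_apply]
          rw [e1, e2]
          exact Ideal.mul_mem_mul (Ideal.pow_mem_pow hf k) hg
      · have := (hfd.pow k).mul hgd
        convert this using 1
        rw [Nat.sub_add_cancel hl1]; ring
    apply le_antisymm
    · exact Nat.sInf_le hmem
    · refine le_csInf (s := {d | ∃ f ∈ bFam a t m (k * (N + 1) + l), f ≠ 0 ∧ MvPolynomial.IsHomogeneous f d}) ⟨_, hmem⟩ ?_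
      rintro d ⟨f, hf, h0, hd⟩
      refine le_of_mem_pow h0 hd ?_
      revert hf
      apply SetLike.le_def.mp
      unfold bFam
      apply iSup_le
      rintro ⟨c, hc⟩
      subst hN
      have h1 : ∏ i : Fin (m - t + 1), a (t + i.1) ^ c i ≤
          ∏ i : Fin (m - t + 1), (idealOfVars (Fin n) K ^ (q + (i.1 + 1))) ^ c i := by
        apply Finset.prod_le_prod'
        intro i _
        apply Ideal.pow_right_mono
        rw [← hal i.1 (by omega)]
        exact alpha_le_pow _ (hhom _ (by omega) (by omega))
      refine h1.trans ?_
      simp only [← pow_mul]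
      rw [Finset.prod_pow_eq_pow_sum]
      apply Ideal.pow_le_pow_right
      have h2 : ∑ i : Fin (m - t + 1), (q + (i.1 + 1)) * c i
          = q * ∑ i, c i + ∑ i : Fin (m - t + 1), (i.1 + 1) * c i := by
        rw [Finset.mul_sum, ← Finset.sum_add_distrib]
        exact Finset.sum_congr rfl fun i _ => by ring
      rw [h2, hc, add_comm]
      apply Nat.add_le_add_right
      apply Nat.mul_le_mul_left
      have h3 : ∑ i : Fin (m - t + 1), (i.1 + 1) * c i ≤ (m - t + 1) * ∑ i, c i := by
        rw [Finset.mul_sum]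
        exact Finset.sum_le_sum fun i _ => Nat.mul_le_mul_right _ (by omega)
      rw [hc] at h3
      by_contra hlt
      have h4 : ∑ i, c i ≤ k := by omega
      have := Nat.mul_le_mul_left (m - t + 1) h4
      rw [mul_comm (m - t + 1) k] at this
      omega
  rw [main]
  have e1 : (alphaDeg (a 1) : ℤ) + t = q + 2 := by exact_mod_cast hq
  have e2 : (N : ℤ) = m - t := by omega
  push_cast
  rw [e2]
  linear_combination (-(k : ℤ) - 1) * e1
end

section
/- Let k be a field, R = k[x_1,…,x_n] the standard-graded polynomial ring, and a_1,…,a_m nonzero proper homogeneous ideals of R satisfying α(a_{t+1}) = α(a_1) + t for all 0 ≤ t ≤ m−1 (property (P2)). Fix 1 ≤ t < m and for s ≥ 1 let b_{t,s} := ∑ over all tuples (c_1,…,c_{m−t+1}) of non-negative integers with ∑_{i=1}^{m−t+1} i·c_i = s of the product ideal a_t^{c_1} a_{t+1}^{c_2} ⋯ a_m^{c_{m−t+1}}. Then the sequence α(b_{t,s})/s converges as s → ∞, and its limit equals (α(a_1)+m−1)/(m−t+1). (Under property (P1) this limit is the Waldschmidt constant of a_t.) -/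
open MvPolynomial Filter

attribute [local instance] MvPolynomial.gradedAlgebra

lemma aux_deg_mem {n : ℕ} {K : Type*} [Field K] {f : MvPolynomial (Fin n) K} {d N : ℕ}
    (hf : f ≠ 0) (hd : f.IsHomogeneous d) (hN : f ∈ idealOfVars (Fin n) K ^ N) : N ≤ d := by
  obtain ⟨x, hx⟩ := MvPolynomial.ne_zero_iff.1 hf
  rw [mem_pow_idealOfVars_iff'] at hN
  by_contra hlt
  have h1 := hd.degree_eq_sum_deg_support (mem_support_iff.2 hx)
  exact hx (hN x (by
    have : x.degree = d := by rw [Finsupp.degree_apply]; exact h1.symm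
    omega))

lemma aux_le {n : ℕ} {K : Type*} [Field K] (I : Ideal (MvPolynomial (Fin n) K))
    (hI : Ideal.IsHomogeneous (homogeneousSubmodule (Fin n) K) I) :
    I ≤ idealOfVars (Fin n) K ^ alphaDeg I := by
  intro f hf
  rw [mem_pow_idealOfVars_iff']
  intro x hx
  by_contra hne
  have h1 := homogeneousComponent_mem_of_mem hI hf x.degree
  have h2 : coeff x (homogeneousComponent x.degree f) ≠ 0 := by
    rw [coeff_homogeneousComponent]; simpa using hne
  have : alphaDeg I ≤ x.degree := Nat.sInf_le
    ⟨_, h1, MvPolynomial.ne_zero_iff.2 ⟨x, h2⟩, homogeneousComponent_isHomogeneous _ _⟩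
  omega

lemma aux_attain {n : ℕ} {K : Type*} [Field K] (I : Ideal (MvPolynomial (Fin n) K))
    (hI : Ideal.IsHomogeneous (homogeneousSubmodule (Fin n) K) I) (hne : I ≠ ⊥) :
    ∃ f ∈ I, f ≠ 0 ∧ f.IsHomogeneous (alphaDeg I) := by
  have : {d | ∃ f ∈ I, f ≠ 0 ∧ MvPolynomial.IsHomogeneous f d}.Nonempty := by
    obtain ⟨f, hf, h0⟩ := Submodule.exists_mem_ne_zero_of_ne_bot hne
    obtain ⟨x, hx⟩ := MvPolynomial.ne_zero_iff.1 h0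
    refine ⟨x.degree, _, homogeneousComponent_mem_of_mem hI hf x.degree,
      MvPolynomial.ne_zero_iff.2 ⟨x, ?_⟩, homogeneousComponent_isHomogeneous _ _⟩
    rw [coeff_homogeneousComponent]; simpa using hx
  exact Nat.sInf_mem this

lemma aux_pos {n : ℕ} {K : Type*} [Field K] (I : Ideal (MvPolynomial (Fin n) K))
    (hI : Ideal.IsHomogeneous (homogeneousSubmodule (Fin n) K) I) (hne : I ≠ ⊥)
    (hp : I ≠ ⊤) : 1 ≤ alphaDeg I := by
  by_contra h
  obtain ⟨f, hf, h0, hh⟩ := aux_attain I hI hne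
  have hz : alphaDeg I = 0 := by omega
  rw [hz] at hh
  have h1 := totalDegree_eq_zero_iff_eq_C.1 (hh.totalDegree h0)
  apply hp
  refine Ideal.eq_top_of_isUnit_mem I hf ?_
  rw [h1]
  refine IsUnit.map C (IsUnit.mk0 _ ?_)
  intro h2
  rw [h2, C_0] at h1
  exact h0 h1

lemma aux_upper {n : ℕ} {K : Type*} [Field K] (m t s : ℕ)
    (a : ℕ → Ideal (MvPolynomial (Fin n) K))
    (d : ℕ → ℕ) (hd : ∀ i : Fin (m - t + 1), ∃ f ∈ a (t + i.1), f ≠ 0 ∧ f.IsHomogeneous (d i.1))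
    (c : Fin (m - t + 1) → ℕ) (hc : ∑ i, (i.1 + 1) * c i = s) :
    ∃ f ∈ bFam a t m s, f ≠ 0 ∧ f.IsHomogeneous (∑ i, d i.1 * c i) := by
  choose f hf h0 hh using hd
  refine ⟨∏ i, f i ^ c i, ?_, ?_, ?_⟩
  · exact (le_iSup (fun c : {c : Fin (m - t + 1) → ℕ // ∑ i, (i.1 + 1) * c i = s} =>
      ∏ i : Fin (m - t + 1), a (t + i.1) ^ c.1 i) ⟨c, hc⟩)
      (Ideal.prod_mem_prod fun i _ => Ideal.pow_mem_pow (hf i) _)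
  · exact Finset.prod_ne_zero_iff.2 fun i _ => pow_ne_zero _ (h0 i)
  · exact IsHomogeneous.prod _ _ _ fun i _ => (hh i).pow _

lemma aux_lower {n : ℕ} {K : Type*} [Field K] (m t s N : ℕ)
    (a : ℕ → Ideal (MvPolynomial (Fin n) K))
    (d : ℕ → ℕ) (hd : ∀ i : Fin (m - t + 1), a (t + i.1) ≤ idealOfVars (Fin n) K ^ d i.1)
    (hN : ∀ c : Fin (m - t + 1) → ℕ, ∑ i, (i.1 + 1) * c i = s → N ≤ ∑ i, d i.1 * c i) :
    bFam a t m s ≤ idealOfVars (Fin n) K ^ N := by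
  refine iSup_le fun c => ?_
  calc ∏ i : Fin (m - t + 1), a (t + i.1) ^ c.1 i
      ≤ ∏ i : Fin (m - t + 1), (idealOfVars (Fin n) K ^ d i.1) ^ c.1 i :=
        Finset.prod_le_prod' fun i _ => Ideal.pow_right_mono (hd i) _
    _ = idealOfVars (Fin n) K ^ (∑ i, d i.1 * c.1 i) := by
        simp_rw [← pow_mul]; rw [Finset.prod_pow_eq_pow_sum]
    _ ≤ _ := Ideal.pow_le_pow_right (hN c.1 c.2)

lemma aux_c (p s D : ℕ) (d : ℕ → ℕ) (hlast : d p = D) (hle : ∀ i, i ≤ p → d i ≤ D) :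
    ∃ c : Fin (p + 1) → ℕ, ∑ i, (i.1 + 1) * c i = s ∧
      ∑ i, d i.1 * c i ≤ D * (s / (p + 1)) + D := by
  have key : ∀ (g : ℕ → ℕ) (j : Fin (p+1)) (v : ℕ),
      ∑ i, g i.1 * (Pi.single j v : Fin (p+1) → ℕ) i = g j.1 * v := by
    intro g j v
    rw [Finset.sum_eq_single j]
    · simp
    · intro b _ hb; simp [hb]
    · simp
  have hdm := Nat.div_add_mod s (p+1)
  have hlt : s % (p + 1) < p + 1 := Nat.mod_lt s (Nat.succ_pos p)
  by_cases hr : s % (p + 1) = 0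
  · refine ⟨Pi.single (Fin.last p) (s / (p+1)), ?_, ?_⟩
    · rw [key (fun i => i + 1)]; simp only [Fin.val_last]; omega
    · rw [key d]; simp [hlast]
  · refine ⟨Pi.single (Fin.last p) (s / (p+1)) + Pi.single ⟨s % (p+1) - 1, by omega⟩ 1, ?_, ?_⟩
    · simp only [Pi.add_apply, mul_add, Finset.sum_add_distrib]
      rw [key (fun i => i + 1), key (fun i => i + 1)]; simp only [Fin.val_last]; omega
    · simp only [Pi.add_apply, mul_add, Finset.sum_add_distrib]
      rw [key d, key d]
      have := hle (s % (p+1) - 1) (by omega)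
      simp only [Fin.val_last, hlast]; omega

/-- Theorem 2.4, second part: under property (P2), `α(b_{t,s})/s` converges as `s → ∞` to
`(α(a_1) + m - 1)/(m - t + 1)` (which under (P1) is the Waldschmidt constant of `a_t`). -/
theorem waldschmidt_of_symbolic_family {n : ℕ} {K : Type*} [Field K] (m : ℕ)
    (a : ℕ → Ideal (MvPolynomial (Fin n) K))
    (hne : ∀ i, 1 ≤ i → i ≤ m → a i ≠ ⊥)
    (hproper : ∀ i, 1 ≤ i → i ≤ m → a i ≠ ⊤)
    (hhom : ∀ i, 1 ≤ i → i ≤ m →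
      Ideal.IsHomogeneous (homogeneousSubmodule (Fin n) K) (a i))
    (hP2 : ∀ t, t ≤ m - 1 → alphaDeg (a (t + 1)) = alphaDeg (a 1) + t)
    (t : ℕ) (ht1 : 1 ≤ t) (htm : t < m) :
    Tendsto (fun s : ℕ => (alphaDeg (bFam a t m s) : ℝ) / s) atTop
      (nhds (((alphaDeg (a 1) : ℝ) + m - 1) / ((m : ℝ) - t + 1))) := by
  have hA : 1 ≤ alphaDeg (a 1) :=
    aux_pos _ (hhom 1 le_rfl (by omega)) (hne 1 le_rfl (by omega)) (hproper 1 le_rfl (by omega))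
  obtain ⟨p, rfl⟩ : ∃ p, m = t + p := ⟨m - t, by omega⟩
  have hp : t + p - t = p := by omega
  set A := alphaDeg (a 1) with hAdef
  obtain ⟨B, hB⟩ : ∃ B, A + t = B + 2 := ⟨A + t - 2, by omega⟩
  have hal : ∀ i, i ≤ p → alphaDeg (a (t + i)) = B + 1 + i := by
    intro i hi
    have := hP2 (t + i - 1) (by omega)
    rw [show t + i - 1 + 1 = t + i by omega] at this
    omega
  have hlow : ∀ s : ℕ, ∀ c : Fin (t + p - t + 1) → ℕ, ∑ i, (i.1 + 1) * c i = s →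
      (B + 1 + p) * s ≤ (p + 1) * ∑ i, (B + 1 + i.1) * c i := by
    intro s c hc
    rw [← hc, Finset.mul_sum, Finset.mul_sum]
    refine Finset.sum_le_sum fun i _ => ?_
    obtain ⟨j, hj⟩ : ∃ j, p = i.1 + j := ⟨p - i.1, by omega⟩
    rw [← mul_assoc, ← mul_assoc]
    refine Nat.mul_le_mul_right _ ?_
    have gen : ∀ k q : ℕ, q = k + j → (B + 1 + q) * (k + 1) ≤ (q + 1) * (B + 1 + k) := by
      rintro k q rfl
      nlinarith [Nat.zero_le (B * j)]
    exact gen _ _ hj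
  have hq : (0 : ℝ) < (p : ℝ) + 1 := by positivity
  have hbound : ∀ s : ℕ, ((B + 1 + p : ℕ) : ℝ) * s / (p + 1) ≤ alphaDeg (bFam a t (t + p) s) ∧
      (alphaDeg (bFam a t (t + p) s) : ℝ) ≤
        ((B + 1 + p : ℕ) : ℝ) * s / (p + 1) + (B + 1 + p : ℕ) := by
    intro s
    have hatt : ∀ i : Fin (t + p - t + 1), ∃ f ∈ a (t + i.1), f ≠ 0 ∧
        f.IsHomogeneous ((fun i => B + 1 + i) i.1) := by
      intro i
      have := aux_attain _ (hhom (t + i.1) (by omega) (by omega)) (hne _ (by omega) (by omega))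
      rwa [hal i.1 (by omega)] at this
    obtain ⟨c, hc, hcD⟩ : ∃ c : Fin (t + p - t + 1) → ℕ, ∑ i, (i.1 + 1) * c i = s ∧
        ∑ i, (fun i => B + 1 + i) i.1 * c i ≤ (B + 1 + p) * (s / (p + 1)) + (B + 1 + p) := by
      rw [hp]
      exact aux_c p s (B + 1 + p) (fun i => B + 1 + i) rfl (fun i hi => by simpa using hi)
    have hup := aux_upper (t + p) t s a (fun i => B + 1 + i) hatt c hc
    constructor
    · have hmem : alphaDeg (bFam a t (t + p) s) ∈
          {d | ∃ f ∈ bFam a t (t + p) s, f ≠ 0 ∧ MvPolynomial.IsHomogeneous f d} :=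
        Nat.sInf_mem ⟨_, hup⟩
      obtain ⟨f, hf, h0, hh⟩ := hmem
      have hle := aux_lower (t + p) t s ⌈((B + 1 + p : ℕ) : ℝ) * s / (p + 1)⌉₊ a
        (fun i => B + 1 + i) (fun i => by
          have := aux_le _ (hhom (t + i.1) (by omega) (by omega))
          rwa [hal i.1 (by omega)] at this) (fun c hc => by
          rw [Nat.ceil_le, div_le_iff₀ hq]
          have := hlow s c hc
          rw [mul_comm (p + 1)] at this
          exact_mod_cast this)
      exact (Nat.le_ceil _).trans (by exact_mod_cast aux_deg_mem h0 hh (hle hf))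
    · have h1 : alphaDeg (bFam a t (t + p) s) ≤ (B + 1 + p) * (s / (p + 1)) + (B + 1 + p) :=
        (Nat.sInf_le hup).trans hcD
      have h2 : ((s / (p + 1) : ℕ) : ℝ) ≤ (s : ℝ) / (p + 1) := by
        have := @Nat.cast_div_le ℝ _ _ _ s (p + 1)
        simpa using this
      have h3 : (alphaDeg (bFam a t (t + p) s) : ℝ) ≤
          ((B + 1 + p : ℕ) : ℝ) * ((s / (p + 1) : ℕ) : ℝ) + (B + 1 + p : ℕ) := by
        exact_mod_cast h1
      have h4 := mul_le_mul_of_nonneg_left h2 (Nat.cast_nonneg (α := ℝ) (B + 1 + p))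
      rw [mul_div_assoc]
      linarith
  have hL : ((A : ℝ) + ((t + p : ℕ) : ℝ) - 1) / (((t + p : ℕ) : ℝ) - t + 1)
      = ((B + 1 + p : ℕ) : ℝ) / (p + 1) := by
    have hB' : (A : ℝ) + t = B + 2 := by exact_mod_cast hB
    push_cast
    congr 1 <;> linarith
  rw [hL]
  have hlim : Tendsto (fun s : ℕ => ((B + 1 + p : ℕ) : ℝ) / (p + 1) + ((B + 1 + p : ℕ) : ℝ) / s)
      atTop (nhds (((B + 1 + p : ℕ) : ℝ) / (p + 1))) := by
    simpa using (tendsto_const_nhds (x := ((B + 1 + p : ℕ) : ℝ) / (p + 1))).add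
      (tendsto_const_div_atTop_nhds_zero_nat ((B + 1 + p : ℕ) : ℝ))
  refine tendsto_of_tendsto_of_tendsto_of_le_of_le' tendsto_const_nhds hlim ?_ ?_
  · filter_upwards [eventually_gt_atTop 0] with s hs
    have hs' : (0 : ℝ) < s := by exact_mod_cast hs
    rw [le_div_iff₀ hs', div_mul_eq_mul_div]
    exact (hbound s).1
  · filter_upwards [eventually_gt_atTop 0] with s hs
    have hs' : (0 : ℝ) < s := by exact_mod_cast hs
    rw [div_le_iff₀ hs', add_mul, div_mul_cancel₀ _ hs'.ne', div_mul_eq_mul_div]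
    exact (hbound s).2
end

section
/- Let R be a commutative ring and a_1,…,a_m ideals of R with a_i ⊆ a_1^i for all 2 ≤ i ≤ m. Fix 1 ≤ t ≤ m, a non-negative integer N, and a positive integer k; set s_k = k(N+t)(m−t+1) and r_k = km. For s ≥ 1 let b_{t,s} := ∑ over all tuples (c_1,…,c_{m−t+1}) of non-negative integers with ∑_{i=1}^{m−t+1} i·c_i = s of the product ideal a_t^{c_1} a_{t+1}^{c_2} ⋯ a_m^{c_{m−t+1}}. Then b_{t,s_k} ⊆ a_1^{(N+t)r_k}. -/
/-- The `j = 1` containment in Theorem 3.1: if `a_i ⊆ a_1 ^ i` for all `2 ≤ i ≤ m`, then with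
`s_k = k(N+t)(m-t+1)` and `r_k = km` one has `b_{t, s_k} ⊆ a_1 ^ ((N+t) r_k)`. -/
theorem bFam_containment_linear {R : Type*} [CommRing R] (a : ℕ → Ideal R) (m t N k : ℕ)
    (ht1 : 1 ≤ t) (htm : t ≤ m) (hk : 0 < k)
    (hsub : ∀ i : ℕ, 2 ≤ i → i ≤ m → a i ≤ a 1 ^ i) :
    bFam a t m (k * (N + t) * (m - t + 1)) ≤ a 1 ^ ((N + t) * (k * m)) := by
  unfold bFam
  refine iSup_le ?_
  rintro ⟨c, hc⟩
  have h1 : ∀ i : ℕ, 1 ≤ i → i ≤ m → a i ≤ a 1 ^ i := by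
    intro i hi him
    rcases Nat.lt_or_ge 1 i with h | h
    · exact hsub i h him
    · have : i = 1 := by omega
      subst this
      simp
  have h2 : ∏ i : Fin (m - t + 1), a (t + i.1) ^ c i
      ≤ ∏ i : Fin (m - t + 1), a 1 ^ ((t + i.1) * c i) := by
    refine Finset.prod_le_prod' ?_
    intro i _
    rw [pow_mul]
    exact Ideal.pow_right_mono (h1 _ (by omega) (by have := i.2; omega)) _
  refine h2.trans ?_
  rw [Finset.prod_pow_eq_pow_sum]
  refine Ideal.pow_le_pow_right ?_
  refine Nat.le_of_mul_le_mul_left ?_ (Nat.succ_pos (m - t))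
  have key : ∀ j : ℕ, j ≤ m - t → m * (j + 1) ≤ (m - t + 1) * (t + j) := by
    clear h2 hc c
    intro j hj
    obtain ⟨e, he⟩ : ∃ e, m - t = j + e := ⟨m - t - j, by omega⟩
    obtain ⟨u, rfl⟩ : ∃ u, t = u + 1 := ⟨t - 1, by omega⟩
    have hm : m = u + 1 + (j + e) := by omega
    rw [he, hm]
    nlinarith [Nat.zero_le (u * e)]
  have h3 : m * ∑ i : Fin (m - t + 1), (i.1 + 1) * c i
      ≤ (m - t + 1) * ∑ i : Fin (m - t + 1), (t + i.1) * c i := by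
    rw [Finset.mul_sum, Finset.mul_sum]
    refine Finset.sum_le_sum ?_
    intro i _
    rw [← mul_assoc, ← mul_assoc]
    refine Nat.mul_le_mul_right _ ?_
    exact key i.1 (by have := i.2; omega)
  rw [hc] at h3
  refine le_trans (le_of_eq ?_) h3
  simp only [Nat.succ_eq_add_one]
  ring
end

section
/- Let k be a field, R = k[x,y,z] with the standard grading and 𝔪 = (x,y,z). Let a_1, b_1, c_1, a_2, b_2, c_2 ∈ k and let I be the ideal generated by the 2×2 minors of the matrix with rows (x, y, a_1x+b_1y+c_1z) and (y, z, a_2x+b_2y+c_2z). Assume I cannot be generated by fewer than 3 elements. Then I^{(2)} ⊆ 𝔪I, where I^{(2)} is the second symbolic power of I. -/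
open MvPolynomial

/-- The `s`-th symbolic power of an ideal: the intersection over the associated primes `p` of
`R ⧸ I` of the contractions of `I^s` localized at `p`. -/
noncomputable def symbolicPower {R : Type*} [CommRing R] (I : Ideal R) (s : ℕ) : Ideal R :=
  ⨅ p : {p : Ideal R // p ∈ associatedPrimes R (R ⧸ I)},
    letI : p.1.IsPrime := p.2.isPrime
    Ideal.comap (algebraMap R (Localization.AtPrime p.1))
      (Ideal.map (algebraMap R (Localization.AtPrime p.1)) (I ^ s))

/-- An element of the symbolic square is multiplied into the square by a regular element. -/
lemma aux_exists_regular {R : Type*} [CommRing R] [IsNoetherianRing R] (I : Ideal R) (f : R)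
    (hf : f ∈ symbolicPower I 2) :
    ∃ s : R, s * f ∈ I ^ 2 ∧ ∀ t, s * t ∈ I → t ∈ I := by
  let J : Ideal R := Submodule.comap (LinearMap.toSpanSingleton R R f) (I ^ 2)
  have hJ : ∀ s, s ∈ J ↔ s * f ∈ I ^ 2 := fun s => by simp [J]
  by_contra hcon
  push Not at hcon
  have hsub : (J : Set R) ⊆ ⋃ p ∈ associatedPrimes R (R ⧸ I), (p : Set R) := by
    intro s hs
    rw [biUnion_associatedPrimes_eq_zero_divisors]
    obtain ⟨t, ht, ht'⟩ := hcon s ((hJ s).1 hs)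
    refine ⟨Ideal.Quotient.mk I t, ?_, ?_⟩
    · rwa [Ne, Ideal.Quotient.eq_zero_iff_mem]
    · rw [← Ideal.Quotient.eq_zero_iff_mem] at ht
      rw [Algebra.smul_def]
      simpa using ht
  obtain ⟨p, hp, hle⟩ := (J.subset_union_prime_finite
    (associatedPrimes.finite R (R ⧸ I)) (f := id) 0 0 fun _ h _ _ ↦ h.isPrime).1 hsub
  have hpp : p.IsPrime := hp.isPrime
  have h1 := (Submodule.mem_iInf _).1 hf ⟨p, hp⟩
  rw [Ideal.mem_comap, IsLocalization.algebraMap_mem_map_algebraMap_iff p.primeCompl] at h1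
  obtain ⟨m, hm, hmf⟩ := h1
  exact hm (hle ((hJ m).2 hmf))

lemma aux_prime {K : Type*} [Field K] :
    Prime ((X 0 : MvPolynomial (Fin 3) K) * X 2 - X 1 ^ 2) := by
  rw [← UniqueFactorizationMonoid.irreducible_iff_prime]
  have hrel : IsRelPrime (X 2 : MvPolynomial (Fin 3) K) (-X 1 ^ 2) := by
    have hp : Prime (X 2 : MvPolynomial (Fin 3) K) := X_prime
    rw [hp.irreducible.isRelPrime_iff_not_dvd, dvd_neg]
    intro h
    have h2 := hp.dvd_of_dvd_pow h
    rw [X_dvd_X] at h2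
    simp at h2
  have := irreducible_mul_X_add (X 2 : MvPolynomial (Fin 3) K) (-X 1 ^ 2) 0 (X_ne_zero _)
    (by simp) (by
      rw [vars_neg]
      intro h
      have := vars_pow _ _ h
      simp at this) hrel
  rwa [mul_comm, ← sub_eq_add_neg] at this

lemma aux_mem_max {K : Type*} [Field K] (f : MvPolynomial (Fin 3) K)
    (hf : constantCoeff f = 0) :
    f ∈ Ideal.span {(X 0 : MvPolynomial (Fin 3) K), X 1, X 2} := by
  have : Ideal.span {(X 0 : MvPolynomial (Fin 3) K), X 1, X 2}
      = Ideal.span (X '' (Set.univ : Set (Fin 3))) := by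
    congr 1
    ext g
    simp [Fin.exists_fin_succ, eq_comm]
  rw [this, mem_ideal_span_X_image]
  intro m hm
  by_contra hc
  push Not at hc
  have : m = 0 := by ext i; simpa using hc i
  subst this
  exact (mem_support_iff.1 hm) hf

/-- Example 2.5 (Eisenbud–Mazur-type containment): for the ideal `I` of `2×2` minors of the
matrix with rows `(x, y, a₁x+b₁y+c₁z)` and `(y, z, a₂x+b₂y+c₂z)` over `k[x,y,z]`, if `I` cannot
be generated by fewer than 3 elements, then `I⁽²⁾ ⊆ 𝔪 I`. -/
theorem symbolic_square_sub_max_mul {K : Type*} [Field K]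
    (a₁ b₁ c₁ a₂ b₂ c₂ : K) :
    let R := MvPolynomial (Fin 3) K
    let x : R := X 0
    let y : R := X 1
    let z : R := X 2
    let g₁ : R := C a₁ * x + C b₁ * y + C c₁ * z
    let g₂ : R := C a₂ * x + C b₂ * y + C c₂ * z
    let I : Ideal R := Ideal.span {x * z - y ^ 2, x * g₂ - y * g₁, y * g₂ - z * g₁}
    let 𝔪 : Ideal R := Ideal.span {x, y, z}
    (∀ S : Finset R, Ideal.span (S : Set R) = I → 3 ≤ S.card) →
    symbolicPower I 2 ≤ 𝔪 * I := by
  intro R x y z g₁ g₂ I 𝔪 hgen f hf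
  obtain ⟨s, hs, hreg⟩ := aux_exists_regular I f hf
  set q₁ : R := x * z - y ^ 2 with hq₁
  set q₂ : R := x * g₂ - y * g₁ with hq₂
  set q₃ : R := y * g₂ - z * g₁ with hq₃
  have hprime : Prime q₁ := aux_prime
  have m₁ : q₁ ∈ I := Ideal.subset_span (Or.inl rfl)
  have m₂ : q₂ ∈ I := Ideal.subset_span (Or.inr (Or.inl rfl))
  have m₃ : q₃ ∈ I := Ideal.subset_span (Or.inr (Or.inr rfl))
  have hnd : ¬ q₁ ∣ q₂ := by
    rintro ⟨t, ht⟩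
    classical
    have h := hgen {q₁, q₃} (by
      apply le_antisymm
      · rw [Ideal.span_le]
        intro g hg
        simp only [Finset.coe_insert, Finset.coe_singleton, Set.mem_insert_iff,
          Set.mem_singleton_iff] at hg
        rcases hg with rfl | rfl
        · exact m₁
        · exact m₃
      · rw [Ideal.span_le]
        intro g hg
        simp only [Set.mem_insert_iff, Set.mem_singleton_iff] at hg
        rcases hg with h | h | h
        · rw [h, ← hq₁]; exact Ideal.subset_span (by simp)
        · rw [h, ← hq₂, ht]; exact Ideal.mul_mem_right _ _ (Ideal.subset_span (by simp))
        · rw [h, ← hq₃]; exact Ideal.subset_span (by simp))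
    have := Finset.card_le_two (a := q₁) (b := q₃)
    omega
  -- representation of elements of I
  have hmem : ∀ g, g ∈ I ↔ ∃ a b c : R, a * q₁ + b * q₂ + c * q₃ = g := by
    intro g
    exact Submodule.mem_span_triple
  have hsq : ∀ g ∈ I ^ 2, ∃ a ∈ I, ∃ b ∈ I, ∃ c ∈ I, a * q₁ + b * q₂ + c * q₃ = g := by
    intro g hg
    rw [pow_two] at hg
    induction hg using Submodule.mul_induction_on' with
    | mem_mul_mem m hm n hn =>
      obtain ⟨a, b, c, rfl⟩ := (hmem n).1 hn
      exact ⟨m * a, I.mul_mem_right _ hm, m * b, I.mul_mem_right _ hm,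
        m * c, I.mul_mem_right _ hm, by ring⟩
    | add g _ h _ hg hh =>
      obtain ⟨a, ha, b, hb, c, hc, rfl⟩ := hg
      obtain ⟨a', ha', b', hb', c', hc', rfl⟩ := hh
      exact ⟨a + a', I.add_mem ha ha', b + b', I.add_mem hb hb', c + c', I.add_mem hc hc',
        by ring⟩
  have hfI : f ∈ I := hreg f (Ideal.pow_le_self two_ne_zero hs)
  obtain ⟨α, β, γ, rfl⟩ := (hmem f).1 hfI
  obtain ⟨a, ha, b, hb, c, hc, habc⟩ := hsq _ hs
  -- the syzygy
  have hsyz : (x * (s * α - a) - g₁ * (s * γ - c)) * q₁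
      + (x * (s * β - b) + y * (s * γ - c)) * q₂ = 0 := by
    linear_combination (-x) * habc - (s * γ - c) * (by ring : x * q₃ - y * q₂ + g₁ * q₁ = 0)
  obtain ⟨t, ht⟩ : q₁ ∣ x * (s * β - b) + y * (s * γ - c) := by
    refine (hprime.dvd_or_dvd ?_).resolve_right hnd
    exact ⟨-(x * (s * α - a) - g₁ * (s * γ - c)), by linear_combination hsyz⟩
  have ht' : x * (s * α - a) - g₁ * (s * γ - c) = - t * q₂ := by
    apply mul_left_cancel₀ hprime.ne_zero
    rw [ht] at hsyz
    linear_combination hsyz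
  have e₁ : x * β + y * γ ∈ I := by
    apply hreg
    have : s * (x * β + y * γ) = q₁ * t + x * b + y * c := by linear_combination ht
    rw [this]
    exact I.add_mem (I.add_mem (I.mul_mem_right _ m₁) (I.mul_mem_left _ hb)) (I.mul_mem_left _ hc)
  have e₂ : x * α - g₁ * γ ∈ I := by
    apply hreg
    have : s * (x * α - g₁ * γ) = (-t) * q₂ + x * a - g₁ * c := by linear_combination ht'
    rw [this]
    exact I.sub_mem (I.add_mem (I.mul_mem_left _ m₂) (I.mul_mem_left _ ha)) (I.mul_mem_left _ hc)
  have hlin : ∀ g ∈ I, ∀ i, constantCoeff (pderiv i g) = 0 := by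
    intro g hg i
    obtain ⟨a, b, c, rfl⟩ := (hmem g).1 hg
    simp [q₁, q₂, q₃, g₁, g₂, x, y, z, Derivation.leibniz, pow_two]
  have hβ : constantCoeff β = 0 := by
    simpa [x, y, z, Derivation.leibniz, pderiv_X] using hlin _ e₁ 0
  have hγ : constantCoeff γ = 0 := by
    simpa [x, y, z, Derivation.leibniz, pderiv_X] using hlin _ e₁ 1
  have hα : constantCoeff α = 0 := by
    simpa [g₁, x, y, z, Derivation.leibniz, pderiv_X, hγ] using hlin _ e₂ 0
  exact Ideal.add_mem _ (Ideal.add_mem _ (Ideal.mul_mem_mul (aux_mem_max _ hα) m₁)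
    (Ideal.mul_mem_mul (aux_mem_max _ hβ) m₂)) (Ideal.mul_mem_mul (aux_mem_max _ hγ) m₃)
end

section
/- Let k be a field, R = k[x,y,z] with the standard grading and 𝔪 = (x,y,z). Let a_1, b_1, c_1, a_2, b_2, c_2 ∈ k and let I be the ideal generated by the 2×2 minors of the matrix with rows (x, y, a_1x+b_1y+c_1z) and (y, z, a_2x+b_2y+c_2z). Assume I cannot be generated by fewer than 3 elements. Then the Waldschmidt constant of I equals 3/2 (i.e., α(I^{(s)})/s → 3/2 as s → ∞), and the resurgence and asymptotic resurgence of I both equal 4/3, i.e., ρ(I) = ρ̂(I) = α(I)/α̂(I) = 4/3. -/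
open MvPolynomial Filter

/-- The resurgence `ρ(I) = sup { s/r : I⁽ˢ⁾ ⊄ Iʳ }`. -/
noncomputable def resurgence {R : Type*} [CommRing R] (I : Ideal R) : ℝ :=
  sSup {x : ℝ | ∃ s r : ℕ, 0 < s ∧ 0 < r ∧ x = (s : ℝ) / r ∧ ¬ symbolicPower I s ≤ I ^ r}

/-- The asymptotic resurgence `ρ̂(I) = sup { s/r : I⁽ˢᵀ⁾ ⊄ Iʳᵀ for all T ≫ 0 }`. -/
noncomputable def asympResurgence {R : Type*} [CommRing R] (I : Ideal R) : ℝ :=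
  sSup {x : ℝ | ∃ s r : ℕ, 0 < s ∧ 0 < r ∧ x = (s : ℝ) / r ∧
    ∀ᶠ T in atTop, ¬ symbolicPower I (s * T) ≤ I ^ (r * T)}


namespace SelfLinked

section Sym
variable {R : Type*} [CommRing R]

lemma mem_symb_iff (I : Ideal R) (s : ℕ) (f : R) :
    f ∈ symbolicPower I s ↔ ∀ p ∈ associatedPrimes R (R ⧸ I), ∃ u, u ∉ p ∧ u * f ∈ I ^ s := by
  unfold symbolicPower
  rw [Ideal.mem_iInf]
  constructor
  · intro h p hp
    have hpp : p.IsPrime := hp.isPrime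
    have := h ⟨p, hp⟩
    rw [Ideal.mem_comap,
      IsLocalization.algebraMap_mem_map_algebraMap_iff p.primeCompl] at this
    exact this
  · rintro h ⟨p, hp⟩
    have hpp : p.IsPrime := hp.isPrime
    rw [Ideal.mem_comap,
      IsLocalization.algebraMap_mem_map_algebraMap_iff p.primeCompl]
    exact h p hp

lemma exists_nzd [IsNoetherianRing R] (I : Ideal R) (s : ℕ) (f : R) (hf : f ∈ symbolicPower I s) :
    ∃ u, u * f ∈ I ^ s ∧ ∀ v, u * v ∈ I → v ∈ I := by
  rw [mem_symb_iff] at hf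
  let J : Ideal R := (I ^ s).colon {f}
  have hJ : ∀ u, u ∈ J ↔ u * f ∈ I ^ s := by
    intro u; simp [J, Submodule.mem_colon_singleton]
  have h1 : ¬ ((J : Set R) ⊆ ⋃ p ∈ associatedPrimes R (R ⧸ I), p) := by
    intro h
    obtain ⟨p, hp, hle⟩ := (Ideal.subset_union_prime_finite (associatedPrimes.finite R (R ⧸ I))
      (f := id) 0 0 (fun _ h _ _ => h.isPrime)).1 h
    obtain ⟨u, hu, huf⟩ := hf p hp
    exact hu (hle ((hJ u).2 huf))
  rw [Set.not_subset] at h1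
  obtain ⟨u, hu, hu2⟩ := h1
  refine ⟨u, (hJ u).1 hu, ?_⟩
  intro v hv
  by_contra hvI
  apply hu2
  rw [biUnion_associatedPrimes_eq_zero_divisors]
  refine ⟨Ideal.Quotient.mk I v, ?_, ?_⟩
  · rwa [Ne, Ideal.Quotient.eq_zero_iff_mem]
  · change Ideal.Quotient.mk I (u * v) = 0
    rwa [Ideal.Quotient.eq_zero_iff_mem]

lemma assoc_elt [IsNoetherianRing R] (I : Ideal R) (p : Ideal R)
    (hp : p ∈ associatedPrimes R (R ⧸ I)) :
    ∃ f, f ∉ I ∧ ∀ u, u ∈ p ↔ u * f ∈ I := by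
  rw [AssociatedPrimes.mem_iff, isAssociatedPrime_iff] at hp
  obtain ⟨hp, x, hx⟩ := hp
  obtain ⟨f, rfl⟩ := Ideal.Quotient.mk_surjective x
  have key : ∀ u, u ∈ p ↔ u * f ∈ I := by
    intro u
    rw [hx, Submodule.mem_colon_singleton, Submodule.mem_bot]
    change Ideal.Quotient.mk I (u * f) = 0 ↔ _
    rw [Ideal.Quotient.eq_zero_iff_mem]
  refine ⟨f, ?_, key⟩
  intro hf
  exact hp.ne_top ((Ideal.eq_top_iff_one p).2 ((key 1).2 (by simpa using hf)))

end Sym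

section Poly
variable {K : Type*} [Field K]

lemma wh_aeval {σ τ : Type*} (w : τ → ZMod 2) (v : σ → MvPolynomial τ K)
    (hv : ∀ i, IsWeightedHomogeneous w (v i) 0) (f : MvPolynomial σ K) :
    IsWeightedHomogeneous w (aeval v f) 0 := by
  induction f using MvPolynomial.induction_on with
  | C a => simpa using isWeightedHomogeneous_C w a
  | add p q hp hq => simpa using hp.add hq
  | mul_X p i hp => simpa using hp.mul (hv i)

/-- the Veronese map -/
noncomputable def phi : MvPolynomial (Fin 3) K →ₐ[K] MvPolynomial (Fin 2) K :=
  aeval ![X 0 ^ 2, X 0 * X 1, X 1 ^ 2]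

@[simp] lemma phi0 : phi (X 0 : MvPolynomial (Fin 3) K) = X 0 ^ 2 := by simp [phi]
@[simp] lemma phi1 : phi (X 1 : MvPolynomial (Fin 3) K) = X 0 * X 1 := by simp [phi]
@[simp] lemma phi2 : phi (X 2 : MvPolynomial (Fin 3) K) = X 1 ^ 2 := by simp [phi]
@[simp] lemma phiC (a : K) : phi (C a : MvPolynomial (Fin 3) K) = C a := by simp [phi]

/-- parity grading -/
abbrev Par (f : MvPolynomial (Fin 2) K) (n : ZMod 2) : Prop :=
  IsWeightedHomogeneous (fun _ => (1 : ZMod 2)) f n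

lemma par_X (i : Fin 2) : Par (X i : MvPolynomial (Fin 2) K) 1 := isWeightedHomogeneous_X _ _ _

lemma par_phi (f : MvPolynomial (Fin 3) K) : Par (phi f) 0 := by
  apply wh_aeval
  intro i
  fin_cases i
  · exact (par_X 0).pow 2
  · exact (par_X 0).mul (par_X 1)
  · exact (par_X 1).pow 2

lemma par_split (f : MvPolynomial (Fin 2) K) : ∃ a b, f = a + b ∧ Par a 0 ∧ Par b 1 := by
  refine ⟨weightedHomogeneousComponent _ 0 f, weightedHomogeneousComponent _ 1 f, ?_,
    weightedHomogeneousComponent_isWeightedHomogeneous _ _,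
    weightedHomogeneousComponent_isWeightedHomogeneous _ _⟩
  ext d
  rw [coeff_add, coeff_weightedHomogeneousComponent, coeff_weightedHomogeneousComponent]
  have : ∀ a : ZMod 2, a = 0 ∨ a = 1 := by decide
  rcases this (Finsupp.weight (fun _ => (1 : ZMod 2)) d) with h | h <;> simp [h]

lemma par_zero {w : Fin 2 → ZMod 2} {f : MvPolynomial (Fin 2) K} {m n : ZMod 2}
    (h0 : IsWeightedHomogeneous w f m)
    (h1 : IsWeightedHomogeneous w f n) (hmn : m ≠ n) : f = 0 := by
  by_contra h
  exact hmn (h0.inj_right h h1)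

lemma par_cancel {P h : MvPolynomial (Fin 2) K} (hP : P ≠ 0) {a b : ZMod 2} (hPa : Par P a)
    (hPh : Par (P * h) (a + b)) : Par h b := by
  obtain ⟨h0, h1, rfl, H0, H1⟩ := par_split h
  have e0 := hPa.mul H0
  have e1 := hPa.mul H1
  have : ∀ a : ZMod 2, a = 0 ∨ a = 1 := by decide
  rcases this b with rfl | rfl
  · have : P * h1 = 0 := by
      refine par_zero e1 (n := a + 0) ?_ (by simp)
      have := hPh.sub e0
      rwa [mul_add, add_sub_cancel_left] at this
    rcases mul_eq_zero.1 this with h | h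
    · exact absurd h hP
    · simpa [h] using H0
  · have : P * h0 = 0 := by
      refine par_zero e0 (n := a + 1) ?_ (by simp)
      have := hPh.sub e1
      rwa [mul_add, add_sub_cancel_right] at this
    rcases mul_eq_zero.1 this with h | h
    · exact absurd h hP
    · simpa [h] using H1

lemma monomial_fin2 (d : Fin 2 →₀ ℕ) (a : K) :
    monomial d a = C a * X 0 ^ d 0 * X 1 ^ d 1 := by
  rw [monomial_eq, Finsupp.prod_fintype _ _ (by simp), Fin.prod_univ_two, mul_assoc]

lemma weight_fin2 (d : Fin 2 →₀ ℕ) :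
    Finsupp.weight (fun _ => (1 : ZMod 2)) d = ((d 0 + d 1 : ℕ) : ZMod 2) := by
  rw [Finsupp.weight_apply, Finsupp.sum_fintype _ _ (by simp), Fin.sum_univ_two]
  simp

lemma even_mono (i j : ℕ) (h : Even (i + j)) (a : K) :
    ∃ g : MvPolynomial (Fin 3) K, phi g = C a * X 0 ^ i * X 1 ^ j := by
  rcases Nat.even_or_odd i with hi | hi
  · have hj : Even j := by grind
    obtain ⟨k, rfl⟩ := hi
    obtain ⟨l, rfl⟩ := hj
    exact ⟨C a * X 0 ^ k * X 2 ^ l, by simp; ring⟩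
  · have hj : Odd j := by grind
    obtain ⟨k, rfl⟩ := hi
    obtain ⟨l, rfl⟩ := hj
    exact ⟨C a * X 0 ^ k * X 2 ^ l * X 1, by simp; ring⟩

lemma even_lift (f : MvPolynomial (Fin 2) K) (hf : Par f 0) : ∃ g, phi g = f := by
  rw [f.as_sum]
  suffices ∀ d ∈ f.support, ∃ g : MvPolynomial (Fin 3) K, phi g = monomial d (coeff d f) by
    choose! g hg using this
    exact ⟨∑ d ∈ f.support, g d, by rw [map_sum]; exact Finset.sum_congr rfl hg⟩
  intro d hd
  have h1 := hf (mem_support_iff.1 hd)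
  rw [weight_fin2, ZMod.natCast_eq_zero_iff_even] at h1
  rw [monomial_fin2]
  exact even_mono _ _ h1 _

lemma odd_lift (f : MvPolynomial (Fin 2) K) (hf : Par f 1) :
    ∃ g h, f = X 0 * phi g + X 1 * phi h := by
  rw [f.as_sum]
  suffices ∀ d ∈ f.support, ∃ g h : MvPolynomial (Fin 3) K,
      monomial d (coeff d f) = X 0 * phi g + X 1 * phi h by
    choose! g h hg using this
    refine ⟨∑ d ∈ f.support, g d, ∑ d ∈ f.support, h d, ?_⟩
    rw [map_sum, map_sum, Finset.mul_sum, Finset.mul_sum, ← Finset.sum_add_distrib]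
    exact Finset.sum_congr rfl hg
  intro d hd
  have h1 := hf (mem_support_iff.1 hd)
  rw [weight_fin2, ZMod.natCast_eq_one_iff_odd] at h1
  rw [monomial_fin2]
  rcases Nat.even_or_odd (d 0) with hi | hi
  · obtain ⟨l, hl⟩ : Odd (d 1) := by grind
    obtain ⟨g, hg⟩ := even_mono (d 0) (2 * l) (by grind) (coeff d f)
    exact ⟨0, g, by rw [hg, hl]; simp; ring⟩
  · obtain ⟨l, hl⟩ := hi
    obtain ⟨g, hg⟩ := even_mono (2 * l) (d 1) (by grind) (coeff d f)
    exact ⟨g, 0, by rw [hg, hl]; simp; ring⟩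

/-- the conic -/
noncomputable def q1 : MvPolynomial (Fin 3) K := X 0 * X 2 - X 1 ^ 2

@[simp] lemma phi_q1 : phi (q1 : MvPolynomial (Fin 3) K) = 0 := by simp [q1]; ring

noncomputable def iota : MvPolynomial (Fin 2) K →ₐ[K] MvPolynomial (Fin 3) K := aeval ![X 0, X 2]

lemma normal_form (f : MvPolynomial (Fin 3) K) :
    ∃ A B : MvPolynomial (Fin 2) K, q1 ∣ f - (iota A + X 1 * iota B) := by
  induction f using MvPolynomial.induction_on with
  | C a => exact ⟨C a, 0, by simp [iota]⟩
  | add p q hp hq =>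
    obtain ⟨A, B, c, h⟩ := hp
    obtain ⟨A', B', c', h'⟩ := hq
    refine ⟨A + A', B + B', c + c', ?_⟩
    rw [map_add, map_add]
    linear_combination h + h'
  | mul_X p i hp =>
    obtain ⟨A, B, c, h⟩ := hp
    fin_cases i
    · refine ⟨A * X 0, B * X 0, c * X 0, ?_⟩
      have : iota (X 0 : MvPolynomial (Fin 2) K) = X 0 := by simp [iota]
      simp only [map_mul, this]
      change p * X 0 - _ = _
      linear_combination X 0 * h
    · refine ⟨X 0 * X 1 * B, A, c * X 1 - iota B, ?_⟩
      have h0 : iota (X 0 : MvPolynomial (Fin 2) K) = X 0 := by simp [iota]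
      have h1 : iota (X 1 : MvPolynomial (Fin 2) K) = X 2 := by simp [iota]
      simp only [map_mul, h0, h1]
      have : (q1 : MvPolynomial (Fin 3) K) = X 0 * X 2 - X 1 ^ 2 := rfl
      change p * X 1 - _ = _
      linear_combination X 1 * h + iota B * this
    · refine ⟨A * X 1, B * X 1, c * X 2, ?_⟩
      have : iota (X 1 : MvPolynomial (Fin 2) K) = X 2 := by simp [iota]
      simp only [map_mul, this]
      change p * X 2 - _ = _
      linear_combination X 2 * h

lemma phi_iota (A : MvPolynomial (Fin 2) K) : phi (iota A) = expand 2 A := by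
  induction A using MvPolynomial.induction_on with
  | C a => simp [iota]
  | add p q hp hq => simp [hp, hq]
  | mul_X p i hp =>
    rw [map_mul, map_mul, hp, map_mul]
    fin_cases i <;> simp [iota]

lemma ker_phi (f : MvPolynomial (Fin 3) K) (hf : phi f = 0) : q1 ∣ f := by
  obtain ⟨A, B, c, h⟩ := normal_form f
  have h2 := congrArg phi h
  simp only [map_sub, map_add, map_mul, hf, phi_iota, phi_q1, phi1] at h2
  have w0 : ∀ A : MvPolynomial (Fin 2) K,
      IsWeightedHomogeneous (![1, 0] : Fin 2 → ZMod 2) (expand 2 A) 0 := by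
    intro A
    rw [← phi_iota]
    have : phi (iota A) = aeval ![X 0 ^ 2, X 1 ^ 2] A := by
      rw [phi_iota]
      unfold expand
      change aeval _ A = _
      congr 2
      ext i; fin_cases i <;> simp
    rw [this]
    apply wh_aeval
    intro i
    fin_cases i
    · simpa using! (isWeightedHomogeneous_X K (![1, 0] : Fin 2 → ZMod 2) 0).pow 2
    · simpa using! (isWeightedHomogeneous_X K (![1, 0] : Fin 2 → ZMod 2) 1).pow 2
  have e1 : IsWeightedHomogeneous (![1, 0] : Fin 2 → ZMod 2) (X 0 * X 1 * expand 2 B) 1 := by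
    have := ((isWeightedHomogeneous_X K (![1, 0] : Fin 2 → ZMod 2) 0).mul
      (isWeightedHomogeneous_X K (![1, 0] : Fin 2 → ZMod 2) 1)).mul (w0 B)
    simpa using this
  have e2 : X 0 * X 1 * expand 2 B = - expand 2 A := by linear_combination -h2
  have z1 : X 0 * X 1 * expand 2 B = 0 := par_zero e1 (by rw [e2]; exact (w0 A).neg) (by decide)
  have hA : A = 0 := by
    rw [z1] at e2
    rw [← expand_eq_zero (p := 2) (by norm_num)]
    linear_combination e2
  have hB : B = 0 := by
    rw [← expand_eq_zero (p := 2) (by norm_num)]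
    simpa using z1
  subst hA hB
  exact ⟨c, by simpa using h⟩

lemma totalDegree_phi (f : MvPolynomial (Fin 3) K) :
    (phi f).totalDegree ≤ 2 * f.totalDegree := by
  conv_lhs => rw [f.as_sum]
  rw [map_sum]
  apply totalDegree_finsetSum_le
  intro d hd
  have h : phi (monomial d (coeff d f)) =
      C (coeff d f) * (X 0 ^ (2 * d 0 + d 1) * X 1 ^ (d 1 + 2 * d 2)) := by
    rw [monomial_eq, Finsupp.prod_fintype _ _ (by simp), Fin.prod_univ_three]
    simp only [map_mul, map_pow, phi0, phi1, phi2, phiC]; ring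
  have h2 : d 0 + d 1 + d 2 ≤ f.totalDegree := by
    have := le_totalDegree hd
    rwa [Finsupp.sum_fintype _ _ (by simp), Fin.sum_univ_three] at this
  rw [h]
  refine (totalDegree_mul _ _).trans ?_
  refine (add_le_add le_rfl (totalDegree_mul _ _)).trans ?_
  simp only [totalDegree_C, totalDegree_X_pow]
  omega

end Poly

section Main
variable {K : Type*} [Field K]

noncomputable def G2 (p q r : K) : MvPolynomial (Fin 3) K := C p * X 0 + C q * X 1 + C r * X 2
noncomputable def q2 (p q r c : K) : MvPolynomial (Fin 3) K := X 0 * G2 p q r - X 1 * (C c * X 2)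
noncomputable def q3 (p q r c : K) : MvPolynomial (Fin 3) K := X 1 * G2 p q r - X 2 * (C c * X 2)
noncomputable def WW (p q r c : K) : MvPolynomial (Fin 3) K :=
  C c * C p * X 1 + C c * C q * X 2 + C r * G2 p q r
noncomputable def DD (p q r c : K) : MvPolynomial (Fin 3) K :=
  G2 p q r * q2 p q r c - C c * X 2 * q3 p q r c - q1 * WW p q r c
noncomputable def FF (p q r c : K) : MvPolynomial (Fin 2) K :=
  C p * X 0 ^ 3 + C q * X 0 ^ 2 * X 1 + C r * X 0 * X 1 ^ 2 - C c * X 1 ^ 3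
noncomputable def II (p q r c : K) : Ideal (MvPolynomial (Fin 3) K) :=
  Ideal.span {q1, q2 p q r c, q3 p q r c}

variable (p q r c : K)

lemma phi_q2 : phi (q2 p q r c) = X 0 * FF p q r c := by simp [q2, G2, FF]; ring
lemma phi_q3 : phi (q3 p q r c) = X 1 * FF p q r c := by simp [q3, G2, FF]; ring
lemma phi_DD : phi (DD p q r c) = FF p q r c ^ 2 := by
  simp [DD, phi_q2, phi_q3, G2, FF]; ring

lemma q1_mem : q1 ∈ II p q r c := Ideal.subset_span (by simp)
lemma q2_mem : q2 p q r c ∈ II p q r c := Ideal.subset_span (by simp)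
lemma q3_mem : q3 p q r c ∈ II p q r c := Ideal.subset_span (by simp)

lemma m11_mem : X 0 * WW p q r c - (C c * X 2) ^ 2 ∈ II p q r c := by
  have : X 0 * WW p q r c - (C c * X 2) ^ 2 =
      C c * q3 p q r c + C c * C q * q1 + C r * q2 p q r c := by
    simp only [WW, q1, q2, q3, G2]; ring
  rw [this]
  exact add_mem (add_mem (Ideal.mul_mem_left _ _ (q3_mem _ _ _ _)) (Ideal.mul_mem_left _ _ (q1_mem _ _ _ _)))
    (Ideal.mul_mem_left _ _ (q2_mem _ _ _ _))

lemma m22_mem : X 2 * WW p q r c - G2 p q r ^ 2 ∈ II p q r c := by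
  have : X 2 * WW p q r c - G2 p q r ^ 2 =
      -C p * q2 p q r c + -C q * q3 p q r c := by
    simp only [WW, q2, q3, G2]; ring
  rw [this]
  exact add_mem (Ideal.mul_mem_left _ _ (q2_mem _ _ _ _)) (Ideal.mul_mem_left _ _ (q3_mem _ _ _ _))

lemma m12_mem : X 1 * WW p q r c - (C c * X 2) * G2 p q r ∈ II p q r c := by
  have : X 1 * WW p q r c - (C c * X 2) * G2 p q r =
      C r * q3 p q r c + -C c * C p * q1 := by
    simp only [WW, q1, q3, G2]; ring
  rw [this]
  exact add_mem (Ideal.mul_mem_left _ _ (q3_mem _ _ _ _)) (Ideal.mul_mem_left _ _ (q1_mem _ _ _ _))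

lemma mul_mem_sq {R : Type*} [CommRing R] {I : Ideal R} {a b : R} (ha : a ∈ I) (hb : b ∈ I) :
    a * b ∈ I ^ 2 := by rw [pow_two]; exact Ideal.mul_mem_mul ha hb

lemma mul_mem_cube {R : Type*} [CommRing R] {I : Ideal R} {a b c : R} (ha : a ∈ I) (hb : b ∈ I)
    (hc : c ∈ I) : a * b * c ∈ I ^ 3 := by
  rw [pow_succ]; exact Ideal.mul_mem_mul (mul_mem_sq ha hb) hc

lemma DD_mem : DD p q r c ∈ II p q r c :=
  sub_mem (sub_mem (Ideal.mul_mem_left _ _ (q2_mem _ _ _ _)) (Ideal.mul_mem_left _ _ (q3_mem _ _ _ _)))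
    (Ideal.mul_mem_right _ _ (q1_mem _ _ _ _))

lemma X0_DD : X 0 * DD p q r c ∈ II p q r c ^ 2 := by
  have : X 0 * DD p q r c = q2 p q r c * q2 p q r c -
      q1 * (X 0 * WW p q r c - (C c * X 2) ^ 2) := by
    simp only [DD, q1, q2, q3]; ring
  rw [this]
  exact sub_mem (mul_mem_sq (q2_mem _ _ _ _) (q2_mem _ _ _ _)) (mul_mem_sq (q1_mem _ _ _ _) (m11_mem _ _ _ _))

lemma X2_DD : X 2 * DD p q r c ∈ II p q r c ^ 2 := by
  have : X 2 * DD p q r c = q3 p q r c * q3 p q r c -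
      q1 * (X 2 * WW p q r c - G2 p q r ^ 2) := by
    simp only [DD, q1, q2, q3]; ring
  rw [this]
  exact sub_mem (mul_mem_sq (q3_mem _ _ _ _) (q3_mem _ _ _ _)) (mul_mem_sq (q1_mem _ _ _ _) (m22_mem _ _ _ _))

lemma DD_sq : DD p q r c ^ 2 ∈ II p q r c ^ 3 := by
  obtain ⟨A, hA⟩ : ∃ A, A = X 0 * WW p q r c - (C c * X 2) ^ 2 := ⟨_, rfl⟩
  obtain ⟨B, hB⟩ : ∃ B, B = X 2 * WW p q r c - G2 p q r ^ 2 := ⟨_, rfl⟩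
  obtain ⟨E, hE⟩ : ∃ E, E = X 1 * WW p q r c - (C c * X 2) * G2 p q r := ⟨_, rfl⟩
  have hAm := hA ▸ m11_mem p q r c
  have hBm := hB ▸ m22_mem p q r c
  have hEm := hE ▸ m12_mem p q r c
  have : DD p q r c ^ 2 = B * A * q1 - B * q2 p q r c * q2 p q r c
     - E * E * q1 + E * q2 p q r c * q3 p q r c
     + q3 p q r c * E * q2 p q r c - q3 p q r c * A * q3 p q r c := by
    rw [hA, hB, hE]
    simp only [DD, q1, q2, q3]
    ring
  rw [this]
  have h1 := q1_mem p q r c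
  have h2 := q2_mem p q r c
  have h3 := q3_mem p q r c
  exact sub_mem (add_mem (add_mem (sub_mem (sub_mem (mul_mem_cube hBm hAm h1)
    (mul_mem_cube hBm h2 h2)) (mul_mem_cube hEm hEm h1)) (mul_mem_cube hEm h2 h3))
    (mul_mem_cube h3 hEm h2)) (mul_mem_cube h3 hAm h3)

lemma DD_pow (t : ℕ) : DD p q r c ^ t ∈ II p q r c ^ (t + t / 2) := by
  obtain ⟨k, rfl | rfl⟩ := Nat.even_or_odd' t
  · have := Ideal.pow_mem_pow (DD_sq p q r c) k
    rw [← pow_mul, ← pow_mul] at this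
    convert this using 2
    omega
  · have := Ideal.mul_mem_mul (Ideal.pow_mem_pow (DD_sq p q r c) k) (DD_mem p q r c)
    rw [← pow_mul, ← pow_mul, ← pow_succ, ← pow_succ] at this
    convert this using 2
    omega

lemma par_FF : Par (FF p q r c) 1 := by
  have h0 := par_X (K := K) 0
  have h1 := par_X (K := K) 1
  have C0 : ∀ a : K, Par (C a) 0 := fun a => isWeightedHomogeneous_C _ a
  have e1 : Par (C p * X 0 ^ 3) 1 := by simpa using! (C0 p).mul (h0.pow 3)
  have e2 : Par (C q * X 0 ^ 2 * X 1) 1 := by simpa using! ((C0 q).mul (h0.pow 2)).mul h1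
  have e3 : Par (C r * X 0 * X 1 ^ 2) 1 := by simpa using! ((C0 r).mul h0).mul (h1.pow 2)
  have e4 : Par (C c * X 1 ^ 3) 1 := by simpa using! (C0 c).mul (h1.pow 3)
  exact ((e1.add e2).add e3).sub e4

lemma FF_homog : (FF p q r c).IsHomogeneous 3 := by
  have h0 := isHomogeneous_X K (0 : Fin 2)
  have h1 := isHomogeneous_X K (1 : Fin 2)
  have C0 : ∀ a : K, (C a : MvPolynomial (Fin 2) K).IsHomogeneous 0 :=
    fun a => isHomogeneous_C _ a
  exact (((((C0 p).mul (h0.pow 3)).add (((C0 q).mul (h0.pow 2)).mul h1)).add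
    (((C0 r).mul h0).mul (h1.pow 2))).sub ((C0 c).mul (h1.pow 3)))

lemma q1_homog : (q1 : MvPolynomial (Fin 3) K).IsHomogeneous 2 :=
  ((isHomogeneous_X K (0 : Fin 3)).mul (isHomogeneous_X K 2)).sub ((isHomogeneous_X K 1).pow 2)

lemma G2_homog : (G2 p q r).IsHomogeneous 1 :=
  ((((isHomogeneous_C (Fin 3) p).mul (isHomogeneous_X K (0 : Fin 3)))).add
   ((isHomogeneous_C (Fin 3) q).mul (isHomogeneous_X K (1 : Fin 3)))).add
   ((isHomogeneous_C (Fin 3) r).mul (isHomogeneous_X K (2 : Fin 3)))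

lemma cz_homog : (C c * X 2 : MvPolynomial (Fin 3) K).IsHomogeneous 1 :=
  ((isHomogeneous_C (Fin 3) c).mul (isHomogeneous_X K (2 : Fin 3)))

lemma q2_homog : (q2 p q r c).IsHomogeneous 2 :=
  ((isHomogeneous_X K (0 : Fin 3)).mul (G2_homog p q r)).sub
    ((isHomogeneous_X K (1 : Fin 3)).mul (cz_homog c))

lemma q3_homog : (q3 p q r c).IsHomogeneous 2 :=
  ((isHomogeneous_X K (1 : Fin 3)).mul (G2_homog p q r)).sub
    ((isHomogeneous_X K (2 : Fin 3)).mul (cz_homog c))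

lemma WW_homog : (WW p q r c).IsHomogeneous 1 :=
  (((((isHomogeneous_C (Fin 3) c).mul (isHomogeneous_C (Fin 3) p)).mul
    (isHomogeneous_X K (1 : Fin 3)))).add
   (((isHomogeneous_C (Fin 3) c).mul (isHomogeneous_C (Fin 3) q)).mul
    (isHomogeneous_X K (2 : Fin 3)))).add ((isHomogeneous_C (Fin 3) r).mul (G2_homog p q r))

lemma DD_homog : (DD p q r c).IsHomogeneous 3 :=
  (((G2_homog p q r).mul (q2_homog p q r c)).sub ((cz_homog c).mul (q3_homog p q r c))).sub
    (q1_homog.mul (WW_homog p q r c))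

lemma q1_ne : (q1 : MvPolynomial (Fin 3) K) ≠ 0 := by
  intro h
  have := congrArg (MvPolynomial.eval ![1, 0, 1]) h
  simp [q1] at this

lemma homog_mem_pow {f : MvPolynomial (Fin 3) K} (hf : f.IsHomogeneous 2) :
    f ∈ idealOfVars (Fin 3) K ^ 2 := by
  rw [mem_pow_idealOfVars_iff']
  intro x hx
  exact hf.coeff_eq_zero (by omega)

lemma II_le : II p q r c ≤ idealOfVars (Fin 3) K ^ 2 := by
  unfold II
  rw [Ideal.span_le]
  rintro f (rfl | rfl | rfl)
  · exact homog_mem_pow q1_homog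
  · exact homog_mem_pow (q2_homog _ _ _ _)
  · exact homog_mem_pow (q3_homog _ _ _ _)

lemma II_pow_degree {f : MvPolynomial (Fin 3) K} {d n : ℕ} (hf : f.IsHomogeneous d) (h0 : f ≠ 0)
    (hm : f ∈ II p q r c ^ n) : 2 * n ≤ d := by
  have h1 : f ∈ idealOfVars (Fin 3) K ^ (2 * n) := by
    rw [pow_mul]
    exact Ideal.pow_right_mono (II_le p q r c) n hm
  rw [mem_pow_idealOfVars_iff'] at h1
  by_contra hlt
  apply h0
  ext x
  rw [coeff_zero]
  by_cases hx : x.degree < 2 * n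
  · exact h1 x hx
  · exact hf.coeff_eq_zero (by omega)

lemma dvd_of_dvd_sq {F v : MvPolynomial (Fin 2) K} (hF : F ≠ 0) (h0 : F ∣ X 0 ^ 2 * v)
    (h1 : F ∣ X 1 ^ 2 * v) : F ∣ v := by
  obtain ⟨a, ha⟩ := h0
  obtain ⟨b, hb⟩ := h1
  have e : X 1 ^ 2 * a = X 0 ^ 2 * b := by
    apply mul_left_cancel₀ hF
    linear_combination X 0 ^ 2 * hb - X 1 ^ 2 * ha
  have hX : (X 0 : MvPolynomial (Fin 2) K) ≠ 0 := X_ne_zero _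
  have hp : Prime (X 0 : MvPolynomial (Fin 2) K) := MvPolynomial.X_prime
  have hn : ¬ (X 0 : MvPolynomial (Fin 2) K) ∣ X 1 ^ 2 := by
    intro h
    have := hp.dvd_of_dvd_pow h
    rw [X_dvd_X] at this
    simp at this
  have : X 0 ^ 2 ∣ a := hp.pow_dvd_of_dvd_mul_left 2 hn ⟨b, e⟩
  obtain ⟨a', rfl⟩ := this
  refine ⟨a', mul_left_cancel₀ (pow_ne_zero 2 hX) ?_⟩
  linear_combination ha

variable {p q r c}

lemma mem_II_of_dvd (hF : FF p q r c ≠ 0) {f : MvPolynomial (Fin 3) K}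
    (h : FF p q r c ∣ phi f) : f ∈ II p q r c := by
  obtain ⟨h, hh⟩ := h
  have hpar : Par h 1 := by
    refine par_cancel hF (par_FF p q r c) ?_
    rw [← hh]
    exact par_phi f
  obtain ⟨g, g', rfl⟩ := odd_lift h hpar
  have : q1 ∣ f - (q2 p q r c * g + q3 p q r c * g') := by
    apply ker_phi
    rw [map_sub, map_add, map_mul, map_mul, phi_q2, phi_q3, hh]
    ring
  obtain ⟨k, hk⟩ := this
  have : f = q1 * k + (q2 p q r c * g + q3 p q r c * g') := by linear_combination hk
  rw [this]
  exact add_mem (Ideal.mul_mem_right _ _ (q1_mem _ _ _ _)) (add_mem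
    (Ideal.mul_mem_right _ _ (q2_mem _ _ _ _)) (Ideal.mul_mem_right _ _ (q3_mem _ _ _ _)))

lemma dvd_of_mem_pow {f : MvPolynomial (Fin 3) K} {n : ℕ} (h : f ∈ II p q r c ^ n) :
    FF p q r c ^ n ∣ phi f := by
  have h1 : Ideal.map phi (II p q r c) ≤ Ideal.span {FF p q r c} := by
    rw [Ideal.map_le_iff_le_comap, II, Ideal.span_le]
    rintro f (rfl | rfl | rfl)
    · simp
    · simp [phi_q2, Ideal.mem_span_singleton]
    · simp [phi_q3, Ideal.mem_span_singleton]
  have h2 := Ideal.mem_map_of_mem phi h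
  rw [Ideal.map_pow] at h2
  have := Ideal.pow_right_mono h1 n h2
  rwa [Ideal.span_singleton_pow, Ideal.mem_span_singleton] at this

lemma symb_dvd (hF : FF p q r c ≠ 0) {f : MvPolynomial (Fin 3) K} {n : ℕ}
    (h : f ∈ symbolicPower (II p q r c) n) : FF p q r c ^ n ∣ phi f := by
  obtain ⟨u, hu, hnz⟩ := exists_nzd _ _ _ h
  have even : ∀ v, Par v 0 → FF p q r c ∣ phi u * v → FF p q r c ∣ v := by
    intro v hv hd
    obtain ⟨g, rfl⟩ := even_lift v hv
    rw [← map_mul] at hd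
    have := dvd_of_mem_pow (n := 1) (by simpa using hnz g (mem_II_of_dvd hF hd))
    simpa using this
  have all : ∀ v, FF p q r c ∣ phi u * v → FF p q r c ∣ v := by
    intro v hd
    obtain ⟨a, b, rfl, ha, hb⟩ := par_split v
    obtain ⟨w, hw⟩ := hd
    obtain ⟨w0, w1, rfl, hw0, hw1⟩ := par_split w
    have key : phi u * a = FF p q r c * w1 := by
      have e : phi u * a - FF p q r c * w1 = FF p q r c * w0 - phi u * b := by
        linear_combination hw
      have e0 : Par (phi u * a - FF p q r c * w1) 0 := by
        refine IsWeightedHomogeneous.sub ?_ ?_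
        · simpa using! (par_phi u).mul ha
        · exact (par_FF p q r c).mul hw1
      have e1 : Par (phi u * a - FF p q r c * w1) 1 := by
        rw [e]
        refine IsWeightedHomogeneous.sub ?_ ?_
        · simpa using! (par_FF p q r c).mul hw0
        · simpa using! (par_phi u).mul hb
      exact sub_eq_zero.1 (par_zero e0 e1 (by decide))
    have key2 : phi u * b = FF p q r c * w0 := by linear_combination hw - key
    refine dvd_add (even a ha ⟨w1, key⟩) ?_
    apply dvd_of_dvd_sq hF
    · have := even (X 0 * b) ((par_X 0).mul hb) ⟨X 0 * w0, by linear_combination X 0 * key2⟩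
      rw [pow_two, mul_assoc]
      exact this.mul_left _
    · have := even (X 1 * b) ((par_X 1).mul hb) ⟨X 1 * w0, by linear_combination X 1 * key2⟩
      rw [pow_two, mul_assoc]
      exact this.mul_left _
  have rel : IsRelPrime (FF p q r c) (phi u) := by
    intro d ⟨e, he⟩ ⟨e', he'⟩
    have : FF p q r c ∣ e := all e ⟨e', by rw [he, he']; ring⟩
    obtain ⟨k, hk⟩ := this
    have : FF p q r c * (d * k) = FF p q r c * 1 := by
      conv_rhs => rw [mul_one, he, hk]
      ring
    exact IsUnit.of_mul_eq_one _ (mul_left_cancel₀ hF this)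
  have hd := dvd_of_mem_pow hu
  rw [map_mul] at hd
  exact (rel.pow_left).dvd_of_dvd_mul_left hd

lemma assoc_not_mem (hF : FF p q r c ≠ 0) {P : Ideal (MvPolynomial (Fin 3) K)}
    (hP : P ∈ associatedPrimes _ (MvPolynomial (Fin 3) K ⧸ II p q r c)) :
    X 0 ∉ P ∨ X 2 ∉ P := by
  by_contra! h
  obtain ⟨f, hf, hk⟩ := assoc_elt _ _ hP
  have h0 := dvd_of_mem_pow (n := 1) (by simpa using (hk _).1 h.1)
  have h2 := dvd_of_mem_pow (n := 1) (by simpa using (hk _).1 h.2)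
  simp only [map_mul, phi0, phi2, pow_one] at h0 h2
  exact hf (mem_II_of_dvd hF (dvd_of_dvd_sq hF h0 h2))

lemma pair_pow {R : Type*} [CommRing R] {J : Ideal R} {a b : R} (ha : a ∈ J) (hb : b ∈ J) (n : ℕ) :
    (Ideal.span {a} ⊔ Ideal.span {b}) ^ (n + 1) ≤
      Ideal.span {a} * J ^ n ⊔ Ideal.span {b ^ (n + 1)} := by
  have ha' : Ideal.span {a} ≤ J := by rwa [Ideal.span_singleton_le_iff_mem]
  have hb' : Ideal.span {b} ≤ J := by rwa [Ideal.span_singleton_le_iff_mem]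
  induction n with
  | zero => simp
  | succ n ih =>
    rw [pow_succ]
    refine (Ideal.mul_mono_left ih).trans ?_
    rw [Ideal.sup_mul, Ideal.mul_sup, Ideal.mul_sup]
    refine sup_le (sup_le ?_ ?_) (sup_le ?_ ?_)
    · refine le_trans ?_ le_sup_left
      rw [pow_succ, mul_assoc]
      exact Ideal.mul_mono_right (Ideal.mul_mono_right ha')
    · refine le_trans ?_ le_sup_left
      rw [pow_succ, mul_assoc]
      exact Ideal.mul_mono_right (Ideal.mul_mono_right hb')
    · refine le_trans ?_ le_sup_left
      rw [mul_comm]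
      refine Ideal.mul_mono_right ?_
      rw [← Ideal.span_singleton_pow]
      exact Ideal.pow_right_mono hb' _
    · refine le_trans ?_ le_sup_right
      rw [Ideal.span_singleton_mul_span_singleton, ← pow_succ]

lemma colon_aux {l b : MvPolynomial (Fin 3) K} (hb : b ∈ II p q r c) (hb0 : phi b ≠ 0)
    (hl : ∀ f ∈ II p q r c, l * f ∈ Ideal.span {q1} ⊔ Ideal.span {b}) {n : ℕ}
    {g v : MvPolynomial (Fin 3) K} (h : v * (q1 * g) ∈ II p q r c ^ (n + 1)) :
    (l ^ (n + 1) * v) * g ∈ II p q r c ^ n := by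
  have h1 : Ideal.span {l} * II p q r c ≤ Ideal.span {q1} ⊔ Ideal.span {b} := by
    rw [Ideal.span_singleton_mul_le_iff]
    exact hl
  have h2 : l ^ (n + 1) * (v * (q1 * g)) ∈
      Ideal.span {q1} * II p q r c ^ n ⊔ Ideal.span {b ^ (n + 1)} := by
    refine pair_pow (q1_mem _ _ _ _) hb n ?_
    refine Ideal.pow_right_mono h1 (n + 1) ?_
    rw [mul_pow, Ideal.span_singleton_pow]
    exact Ideal.mul_mem_mul (Ideal.mem_span_singleton_self _) h
  obtain ⟨y, hy, z, hz, e⟩ := Submodule.mem_sup.1 h2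
  obtain ⟨y', hy', rfl⟩ := Ideal.mem_span_singleton_mul.1 hy
  obtain ⟨z', rfl⟩ := Ideal.mem_span_singleton.1 hz
  have e2 := congrArg phi e
  simp only [map_add, map_mul, phi_q1, zero_mul, mul_zero, zero_add, map_pow] at e2
  have e3 : phi z' = 0 := (mul_eq_zero.1 e2).resolve_left (pow_ne_zero _ hb0)
  obtain ⟨k, rfl⟩ := ker_phi _ e3
  have : l ^ (n + 1) * v * g = y' + b ^ n * (b * k) := by
    apply mul_left_cancel₀ q1_ne
    linear_combination -e
  rw [this]
  exact add_mem hy' (Ideal.mul_mem_right _ _ (Ideal.pow_mem_pow hb n))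

lemma symb_colon (hF : FF p q r c ≠ 0) {g : MvPolynomial (Fin 3) K} {n : ℕ}
    (h : q1 * g ∈ symbolicPower (II p q r c) (n + 1)) : g ∈ symbolicPower (II p q r c) n := by
  rw [mem_symb_iff] at h ⊢
  intro P hP
  have hprime : P.IsPrime := hP.isPrime
  obtain ⟨v, hv, hvm⟩ := h P hP
  have sp : ∀ a b : MvPolynomial (Fin 3) K, ∀ x y,
      x * a + y * b ∈ Ideal.span {a} ⊔ Ideal.span {b} := fun a b x y =>
    add_mem (Ideal.mem_sup_left (Ideal.mul_mem_left _ _ (Ideal.mem_span_singleton_self _)))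
     (Ideal.mem_sup_right (Ideal.mul_mem_left _ _ (Ideal.mem_span_singleton_self _)))
  have red : ∀ l b : MvPolynomial (Fin 3) K, l * q1 ∈ Ideal.span {q1} ⊔ Ideal.span {b} →
      l * q2 p q r c ∈ Ideal.span {q1} ⊔ Ideal.span {b} →
      l * q3 p q r c ∈ Ideal.span {q1} ⊔ Ideal.span {b} →
      ∀ f ∈ II p q r c, l * f ∈ Ideal.span {q1} ⊔ Ideal.span {b} := by
    intro l b h1 h2 h3 f hf
    rw [II, Ideal.mem_span_insert] at hf
    obtain ⟨x, f', hf', rfl⟩ := hf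
    obtain ⟨y, z, rfl⟩ := Ideal.mem_span_pair.1 hf'
    have : l * (x * q1 + (y * q2 p q r c + z * q3 p q r c)) =
      x * (l * q1) + (y * (l * q2 p q r c) + z * (l * q3 p q r c)) := by ring
    rw [this]
    exact add_mem (Ideal.mul_mem_left _ _ h1) (add_mem (Ideal.mul_mem_left _ _ h2)
      (Ideal.mul_mem_left _ _ h3))
  rcases assoc_not_mem hF hP with h0 | h0
  · refine ⟨X 0 ^ (n + 1) * v, ?_, ?_⟩
    · intro hm
      rcases hprime.mem_or_mem hm with h | h
      · exact h0 (hprime.mem_of_pow_mem _ h)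
      · exact hv h
    · refine colon_aux (q2_mem _ _ _ _) (by rw [phi_q2]; exact mul_ne_zero (X_ne_zero _) hF) ?_ hvm
      apply red
      · simpa using sp q1 (q2 p q r c) (X 0) 0
      · simpa using sp q1 (q2 p q r c) 0 (X 0)
      · convert sp q1 (q2 p q r c) (-(C c * X 2)) (X 1) using 1
        simp only [q1, q2, q3]; ring
  · refine ⟨X 2 ^ (n + 1) * v, ?_, ?_⟩
    · intro hm
      rcases hprime.mem_or_mem hm with h | h
      · exact h0 (hprime.mem_of_pow_mem _ h)
      · exact hv h
    · refine colon_aux (q3_mem _ _ _ _) (by rw [phi_q3]; exact mul_ne_zero (X_ne_zero _) hF) ?_ hvm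
      apply red
      · simpa using sp q1 (q3 p q r c) (X 2) 0
      · convert sp q1 (q3 p q r c) (G2 p q r) (X 1) using 1
        simp only [q1, q2, q3]; ring
      · simpa using sp q1 (q3 p q r c) 0 (X 2)

lemma DD_mul_symb (hF : FF p q r c ≠ 0) (t m : ℕ) {g : MvPolynomial (Fin 3) K}
    (hg : g ∈ II p q r c ^ m) :
    DD p q r c ^ t * g ∈ symbolicPower (II p q r c) (2 * t + m) := by
  rw [mem_symb_iff]
  intro P hP
  have hprime : P.IsPrime := hP.isPrime
  have key : ∀ l : MvPolynomial (Fin 3) K, l * DD p q r c ∈ II p q r c ^ 2 →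
      l ^ t * (DD p q r c ^ t * g) ∈ II p q r c ^ (2 * t + m) := by
    intro l hl
    rw [← mul_assoc, ← mul_pow, pow_add, pow_mul]
    exact Ideal.mul_mem_mul (Ideal.pow_mem_pow hl t) hg
  rcases assoc_not_mem hF hP with h0 | h0
  · exact ⟨X 0 ^ t, fun h => h0 (hprime.mem_of_pow_mem _ h), key _ (X0_DD _ _ _ _)⟩
  · exact ⟨X 2 ^ t, fun h => h0 (hprime.mem_of_pow_mem _ h), key _ (X2_DD _ _ _ _)⟩

lemma symb_step (hF : FF p q r c ≠ 0) (n : ℕ) {f : MvPolynomial (Fin 3) K}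
    (hf : f ∈ symbolicPower (II p q r c) (n + 1)) :
    ∃ g ∈ II p q r c ^ ((n + 1) % 2), ∃ f' ∈ symbolicPower (II p q r c) n,
      f = DD p q r c ^ ((n + 1) / 2) * g + q1 * f' := by
  suffices ∃ g ∈ II p q r c ^ ((n + 1) % 2), phi f = phi (DD p q r c ^ ((n + 1) / 2) * g) by
    obtain ⟨g, hg, e⟩ := this
    obtain ⟨f', hf'⟩ := ker_phi (f - DD p q r c ^ ((n + 1) / 2) * g) (by rw [map_sub, e, sub_self])
    refine ⟨g, hg, f', ?_, by linear_combination hf'⟩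
    apply symb_colon hF
    rw [← hf']
    refine sub_mem hf ?_
    have := DD_mul_symb hF ((n + 1) / 2) _ hg
    rwa [Nat.div_add_mod] at this
  obtain ⟨h, hh⟩ := symb_dvd hF hf
  have hFp : Par (FF p q r c ^ (n + 1)) ((n + 1 : ℕ) : ZMod 2) := by
    simpa using! (par_FF p q r c).pow (n + 1)
  have hph := par_phi f
  obtain ⟨k, hk⟩ := Nat.even_or_odd' (n + 1)
  rcases hk with hk | hk
  · have h0 : ((n + 1 : ℕ) : ZMod 2) = 0 := by
      rw [ZMod.natCast_eq_zero_iff_even]; exact ⟨k, by omega⟩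
    have : Par h 0 := by
      refine par_cancel (pow_ne_zero _ hF) hFp ?_
      rw [← hh, h0]; simpa using! hph
    obtain ⟨g, rfl⟩ := even_lift h this
    refine ⟨g, ?_, ?_⟩
    · have : (n + 1) % 2 = 0 := by omega
      rw [this]; simp
    · have : (n + 1) / 2 = k := by omega
      rw [this, hh, map_mul, map_pow, phi_DD, ← pow_mul, hk]
  · have h0 : ((n + 1 : ℕ) : ZMod 2) = 1 := by
      rw [ZMod.natCast_eq_one_iff_odd]; exact ⟨k, by omega⟩
    have : Par h 1 := by
      refine par_cancel (pow_ne_zero _ hF) hFp ?_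
      rw [← hh, h0]; exact hph
    obtain ⟨g, g', rfl⟩ := odd_lift h this
    refine ⟨q2 p q r c * g + q3 p q r c * g', ?_, ?_⟩
    · have : (n + 1) % 2 = 1 := by omega
      rw [this, pow_one]
      exact add_mem (Ideal.mul_mem_right _ _ (q2_mem _ _ _ _)) (Ideal.mul_mem_right _ _ (q3_mem _ _ _ _))
    · have : (n + 1) / 2 = k := by omega
      rw [this, hh, map_mul, map_pow, phi_DD, ← pow_mul, hk, map_add, map_mul, map_mul, phi_q2,
        phi_q3]
      ring

lemma symb_le (hF : FF p q r c ≠ 0) (n : ℕ) :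
    symbolicPower (II p q r c) n ≤ II p q r c ^ (n / 2 + n / 4 + n % 2) := by
  induction n with
  | zero => simp
  | succ n ih =>
    intro f hf
    obtain ⟨g, hg, f', hf', rfl⟩ := symb_step hF n hf
    refine add_mem ?_ ?_
    · have := Ideal.mul_mem_mul (DD_pow p q r c ((n + 1) / 2)) hg
      rw [← pow_add] at this
      convert this using 2
      omega
    · have := Ideal.mul_mem_mul (q1_mem p q r c) (ih hf')
      rw [← pow_succ'] at this
      exact Ideal.pow_le_pow_right (by omega) this

lemma symb_degree (hF : FF p q r c ≠ 0) (n : ℕ) : ∀ f ∈ symbolicPower (II p q r c) n, f ≠ 0 →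
    3 * n ≤ 2 * f.totalDegree := by
  induction n with
  | zero => simp
  | succ n ih =>
    intro f hf h0
    by_cases hphi : phi f = 0
    · obtain ⟨g, rfl⟩ := ker_phi f hphi
      have hg : g ≠ 0 := right_ne_zero_of_mul h0
      have := ih g (symb_colon hF hf) hg
      rw [totalDegree_mul_of_isDomain q1_ne hg, q1_homog.totalDegree q1_ne]
      omega
    · obtain ⟨h, hh⟩ := symb_dvd hF hf
      have h1 := totalDegree_phi f
      have hh0 : h ≠ 0 := by rintro rfl; simp at hh; exact hphi hh
      rw [hh, totalDegree_mul_of_isDomain (pow_ne_zero _ hF) hh0,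
        ((FF_homog p q r c).pow (n + 1)).totalDegree (pow_ne_zero _ hF)] at h1
      omega

lemma DD_ne (hF : FF p q r c ≠ 0) : DD p q r c ≠ 0 := by
  intro h
  have := phi_DD p q r c
  rw [h, map_zero] at this
  exact pow_ne_zero 2 hF this.symm

lemma alpha_le {I : Ideal (MvPolynomial (Fin 3) K)} {f : MvPolynomial (Fin 3) K} {d : ℕ}
    (hf : f ∈ I) (h0 : f ≠ 0) (hd : f.IsHomogeneous d) : alphaDeg I ≤ d :=
  Nat.sInf_le ⟨f, hf, h0, hd⟩

lemma alpha_symb (hF : FF p q r c ≠ 0) (n : ℕ) :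
    3 * n ≤ 2 * alphaDeg (symbolicPower (II p q r c) n) ∧
    2 * alphaDeg (symbolicPower (II p q r c) n) ≤ 3 * n + 1 := by
  have mem : DD p q r c ^ (n / 2) * q1 ^ (n % 2) ∈ symbolicPower (II p q r c) n := by
    have := DD_mul_symb hF (n / 2) (n % 2) (Ideal.pow_mem_pow (q1_mem p q r c) (n % 2))
    rwa [Nat.div_add_mod] at this
  have hne : DD p q r c ^ (n / 2) * q1 ^ (n % 2) ≠ 0 :=
    mul_ne_zero (pow_ne_zero _ (DD_ne hF)) (pow_ne_zero _ q1_ne)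
  have hh := ((DD_homog p q r c).pow (n / 2)).mul ((q1_homog (K := K)).pow (n % 2))
  constructor
  · obtain ⟨f, hf, h0, hd⟩ := Nat.sInf_mem (s := {d | ∃ f ∈ symbolicPower (II p q r c) n,
      f ≠ 0 ∧ MvPolynomial.IsHomogeneous f d}) ⟨_, _, mem, hne, hh⟩
    have := symb_degree hF n f hf h0
    rwa [hd.totalDegree h0] at this
  · have := alpha_le mem hne hh
    omega

lemma alpha_II (hF : FF p q r c ≠ 0) : alphaDeg (II p q r c) = 2 := by
  apply le_antisymm
  · exact alpha_le (q1_mem _ _ _ _) q1_ne q1_homog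
  · obtain ⟨f, hf, h0, hd⟩ := Nat.sInf_mem (s := {d | ∃ f ∈ II p q r c,
      f ≠ 0 ∧ MvPolynomial.IsHomogeneous f d}) ⟨_, _, q1_mem _ _ _ _, q1_ne, q1_homog⟩
    have := II_pow_degree p q r c (n := 1) hd h0 (by simpa using hf)
    rw [mul_one] at this
    exact this

lemma tendsto_alpha (hF : FF p q r c ≠ 0) :
    Tendsto (fun s : ℕ => (alphaDeg (symbolicPower (II p q r c) s) : ℝ) / s) atTop
      (nhds (3 / 2)) := by
  have hlim : Tendsto (fun s : ℕ => (3 / 2 : ℝ) + (1 / 2) * (1 / (s : ℝ))) atTop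
      (nhds (3 / 2 + (1 / 2) * 0)) :=
    tendsto_const_nhds.add (tendsto_one_div_atTop_nhds_zero_nat.const_mul _)
  rw [mul_zero, add_zero] at hlim
  refine tendsto_of_tendsto_of_tendsto_of_le_of_le' tendsto_const_nhds hlim ?_ ?_
  · filter_upwards [eventually_gt_atTop 0] with s hs
    have hs' : (0 : ℝ) < s := by exact_mod_cast hs
    have h := (alpha_symb hF s).1
    have h' : (3 : ℝ) * s ≤ 2 * alphaDeg (symbolicPower (II p q r c) s) := by exact_mod_cast h
    rw [le_div_iff₀ hs']
    linarith
  · filter_upwards [eventually_gt_atTop 0] with s hs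
    have hs' : (0 : ℝ) < s := by exact_mod_cast hs
    have h := (alpha_symb hF s).2
    have h' : (2 : ℝ) * alphaDeg (symbolicPower (II p q r c) s) ≤ 3 * s + 1 := by exact_mod_cast h
    rw [div_le_iff₀ hs']
    have : (3 / 2 + 1 / 2 * (1 / (s : ℝ))) * s = 3 / 2 * s + 1 / 2 := by field_simp
    rw [this]
    linarith

lemma upper (hF : FF p q r c ≠ 0) {s m : ℕ} (h : ¬ symbolicPower (II p q r c) s ≤ II p q r c ^ m) :
    3 * s ≤ 4 * m := by
  by_contra hlt
  exact h ((symb_le hF s).trans (Ideal.pow_le_pow_right (by omega)))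

lemma lower (hF : FF p q r c ≠ 0) {t m : ℕ} (h : 3 * t < 2 * m) :
    ¬ symbolicPower (II p q r c) (2 * t) ≤ II p q r c ^ m := by
  intro hle
  have h1 := DD_mul_symb hF t 0 (g := 1) (by simp)
  rw [mul_one, add_zero] at h1
  have := II_pow_degree p q r c ((DD_homog p q r c).pow t) (pow_ne_zero _ (DD_ne hF)) (hle h1)
  omega

lemma div_le_of {s m : ℕ} (hm : 0 < m) (h : 3 * s ≤ 4 * m) : (s : ℝ) / m ≤ 4 / 3 := by
  have hm' : (0 : ℝ) < m := by exact_mod_cast hm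
  have h' : (3 : ℝ) * s ≤ 4 * m := by exact_mod_cast h
  rw [div_le_iff₀ hm']
  linarith

lemma sup_eq {S : Set ℝ} (hu : ∀ x ∈ S, x ≤ 4 / 3)
    (hl : ∀ n : ℕ, 0 < n → ((2 * (2 * n) : ℕ) : ℝ) / ((3 * n + 1 : ℕ) : ℝ) ∈ S) :
    sSup S = 4 / 3 := by
  apply le_antisymm
  · exact csSup_le ⟨_, hl 1 one_pos⟩ hu
  · have hb : BddAbove S := ⟨_, hu⟩
    have key : ∀ n : ℕ, 0 < n → (4 : ℝ) * n ≤ sSup S * (3 * n + 1) := by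
      intro n hn
      have h := le_csSup hb (hl n hn)
      rw [div_le_iff₀ (by positivity)] at h
      push_cast at h
      linarith
    by_contra! hlt
    obtain ⟨n, hn⟩ := exists_nat_gt (sSup S / (4 - 3 * sSup S))
    rw [div_lt_iff₀ (by linarith)] at hn
    have h1 := key 1 one_pos
    push_cast at h1
    rcases Nat.eq_zero_or_pos n with rfl | hn0
    · simp at hn; linarith
    · have := key n hn0
      linarith

lemma resurgence_eq (hF : FF p q r c ≠ 0) : resurgence (II p q r c) = 4 / 3 := by
  apply sup_eq
  · rintro x ⟨s, m, hs, hm, rfl, h⟩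
    exact div_le_of hm (upper hF h)
  · intro n hn
    exact ⟨2 * (2 * n), 3 * n + 1, by omega, by omega, rfl, lower hF (by omega)⟩

lemma asymp_eq (hF : FF p q r c ≠ 0) : asympResurgence (II p q r c) = 4 / 3 := by
  apply sup_eq
  · rintro x ⟨s, m, hs, hm, rfl, h⟩
    obtain ⟨T, hT, hT0⟩ := (h.and (eventually_gt_atTop 0)).exists
    have := upper hF hT
    refine div_le_of hm ?_
    have h2 : T * (3 * s) ≤ T * (4 * m) := by nlinarith
    exact Nat.le_of_mul_le_mul_left h2 hT0
  · intro n hn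
    refine ⟨2 * (2 * n), 3 * n + 1, by omega, by omega, rfl, ?_⟩
    filter_upwards [eventually_gt_atTop 0] with T hT
    rw [mul_assoc 2]
    refine lower hF ?_
    nlinarith

lemma FF_ne_zero (h : ¬ (p = 0 ∧ q = 0 ∧ r = 0 ∧ c = 0)) : FF p q r c ≠ 0 := by
  intro h0
  apply h
  have hs : FF p q r c = monomial (Finsupp.single 0 3) p +
      monomial (Finsupp.single 0 2 + Finsupp.single 1 1) q +
      monomial (Finsupp.single 0 1 + Finsupp.single 1 2) r - monomial (Finsupp.single 1 3) c := by
    simp [FF, monomial_fin2]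
  rw [hs] at h0
  have c1 := congrArg (coeff (Finsupp.single 0 3)) h0
  have c2 := congrArg (coeff (Finsupp.single 0 2 + Finsupp.single 1 1)) h0
  have c3 := congrArg (coeff (Finsupp.single 0 1 + Finsupp.single 1 2)) h0
  have c4 := congrArg (coeff (Finsupp.single 1 3)) h0
  simp [coeff_monomial, Finsupp.ext_iff, Fin.forall_fin_two] at c1 c2 c3 c4
  exact ⟨c1, c2, c3, c4⟩

end Main

end SelfLinked

/-- Example 2.5: for the ideal `I` of `2×2` minors of the matrix with rows
`(x, y, a₁x+b₁y+c₁z)` and `(y, z, a₂x+b₂y+c₂z)` over `k[x,y,z]`, if `I` cannot be generated by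
fewer than 3 elements, then `α̂(I) = 3/2` and `ρ(I) = ρ̂(I) = α(I)/α̂(I) = 4/3`. -/
theorem waldschmidt_resurgence_self_linked {K : Type*} [Field K]
    (a₁ b₁ c₁ a₂ b₂ c₂ : K) :
    let R := MvPolynomial (Fin 3) K
    let x : R := X 0
    let y : R := X 1
    let z : R := X 2
    let g₁ : R := C a₁ * x + C b₁ * y + C c₁ * z
    let g₂ : R := C a₂ * x + C b₂ * y + C c₂ * z
    let I : Ideal R := Ideal.span {x * z - y ^ 2, x * g₂ - y * g₁, y * g₂ - z * g₁}
    (∀ S : Finset R, Ideal.span (S : Set R) = I → 3 ≤ S.card) →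
    Tendsto (fun s : ℕ => (alphaDeg (symbolicPower I s) : ℝ) / s) atTop (nhds (3 / 2)) ∧
    resurgence I = 4 / 3 ∧ asympResurgence I = 4 / 3 ∧
    (alphaDeg I : ℝ) / (3 / 2) = 4 / 3 := by

  intro R x y z g₁ g₂ I hI
  have hII : I = SelfLinked.II a₂ (b₂ - a₁) (c₂ - b₁) c₁ := by
    have e2 : SelfLinked.q2 a₂ (b₂ - a₁) (c₂ - b₁) c₁ =
        (x * g₂ - y * g₁) - C b₁ * (x * z - y ^ 2) := by
      simp only [SelfLinked.q2, SelfLinked.G2, x, y, z, g₁, g₂, C_sub]; ring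
    have e3 : SelfLinked.q3 a₂ (b₂ - a₁) (c₂ - b₁) c₁ =
        (y * g₂ - z * g₁) + C a₁ * (x * z - y ^ 2) := by
      simp only [SelfLinked.q3, SelfLinked.G2, x, y, z, g₁, g₂, C_sub]; ring
    have m1 : x * z - y ^ 2 ∈ I := Ideal.subset_span (by simp)
    have m2 : x * g₂ - y * g₁ ∈ I := Ideal.subset_span (by simp)
    have m3 : y * g₂ - z * g₁ ∈ I := Ideal.subset_span (by simp)
    have n1 : x * z - y ^ 2 ∈ SelfLinked.II a₂ (b₂ - a₁) (c₂ - b₁) c₁ := SelfLinked.q1_mem _ _ _ _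
    apply le_antisymm
    · rw [Ideal.span_le]
      rintro f (rfl | rfl | rfl)
      · exact n1
      · have := add_mem (SelfLinked.q2_mem a₂ (b₂ - a₁) (c₂ - b₁) c₁)
          (Ideal.mul_mem_left _ (C b₁) n1)
        rw [e2, sub_add_cancel] at this
        exact this
      · have := sub_mem (SelfLinked.q3_mem a₂ (b₂ - a₁) (c₂ - b₁) c₁)
          (Ideal.mul_mem_left _ (C a₁) n1)
        rw [e3, add_sub_cancel_right] at this
        exact this
    · rw [SelfLinked.II, Ideal.span_le]
      rintro f (rfl | rfl | rfl)
      · exact m1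
      · rw [e2]
        exact sub_mem m2 (Ideal.mul_mem_left _ _ m1)
      · rw [e3]
        exact add_mem m3 (Ideal.mul_mem_left _ _ m1)
  have hF : SelfLinked.FF a₂ (b₂ - a₁) (c₂ - b₁) c₁ ≠ 0 := by
    apply SelfLinked.FF_ne_zero
    rintro ⟨h1, h2, h3, h4⟩
    have := hI {SelfLinked.q1} (by
      rw [hII, h1, h2, h3, h4, SelfLinked.II]
      have e2 : SelfLinked.q2 (0 : K) 0 0 0 = 0 := by simp [SelfLinked.q2, SelfLinked.G2]
      have e3 : SelfLinked.q3 (0 : K) 0 0 0 = 0 := by simp [SelfLinked.q3, SelfLinked.G2]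
      rw [e2, e3]
      simp [Ideal.span_insert]
      rfl)
    simp at this
  rw [hII]
  refine ⟨SelfLinked.tendsto_alpha hF, SelfLinked.resurgence_eq hF, SelfLinked.asymp_eq hF, ?_⟩
  rw [SelfLinked.alpha_II hF]
  norm_num
end

section
/- Let k be a field of characteristic zero, R = k[x_0,…,x_n] the standard-graded polynomial ring, and f_1,…,f_m an R-regular sequence of linear forms (so m ≤ n+1). For 1 ≤ c ≤ m let I_{m,c} := ⋂_{1 ≤ i_1 < ⋯ < i_c ≤ m} (f_{i_1},…,f_{i_c}) be the ideal of the codimension-c star configuration. Then the resurgence and asymptotic resurgence of I_{m,c} both equal c(m−c+1)/m, i.e., ρ(I_{m,c}) = ρ̂(I_{m,c}) = α(I_{m,c})/α̂(I_{m,c}) = c(m−c+1)/m. -/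
open MvPolynomial Filter

namespace StarConf

/-- Existence of a set of the `k` largest entries. -/
theorem exists_largest {m : ℕ} (a : Fin m → ℕ) (k : ℕ) (hk : k ≤ m) :
    ∃ T : Finset (Fin m), T.card = k ∧ ∀ i ∈ T, ∀ j, j ∉ T → a j ≤ a i := by
  induction k with
  | zero => exact ⟨∅, rfl, by simp⟩
  | succ k ih =>
    obtain ⟨T, hT, h⟩ := ih (by omega)
    have hne : (Tᶜ).Nonempty := by
      rw [← Finset.card_pos, Finset.card_compl, Fintype.card_fin]; omega
    obtain ⟨x, hx, hmax⟩ := Finset.exists_max_image Tᶜ a hne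
    have hxT : x ∉ T := by simpa using hx
    refine ⟨insert x T, by rw [Finset.card_insert_of_notMem hxT, hT], ?_⟩
    intro i hi j hj
    have hj' : j ≠ x ∧ j ∉ T := by simpa using hj
    rcases Finset.mem_insert.1 hi with rfl | hi
    · exact hmax j (by simpa using hj'.2)
    · exact h i hi j hj'.2

theorem exists_smallest {m : ℕ} (a : Fin m → ℕ) (k : ℕ) (hk : k ≤ m) :
    ∃ T : Finset (Fin m), T.card = k ∧ ∀ i ∈ T, ∀ j, j ∉ T → a i ≤ a j := by
  obtain ⟨T, hT, h⟩ := exists_largest a (m - k) (by omega)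
  refine ⟨Tᶜ, by rw [Finset.card_compl, Fintype.card_fin]; omega, ?_⟩
  intro i hi j hj
  exact h j (by simpa using hj) i (by simpa using hi)

/-- if all `c`-sums are at least `s`, then the truncated total is large -/
theorem total_min {m c : ℕ} (hc1 : 1 ≤ c) (hcm : c ≤ m) (a : Fin m → ℕ) (s r : ℕ)
    (h : ∀ S : Finset (Fin m), S.card = c → s ≤ ∑ i ∈ S, a i) :
    (m - c + 1) * r ≤ ∑ i, min (a i) r ∨ m * s ≤ c * ∑ i, min (a i) r := by
  obtain ⟨S, hS, hmin⟩ := exists_smallest a c hcm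
  by_cases hb : ∃ i ∈ S, r ≤ a i
  · left
    obtain ⟨i, hi, hri⟩ := hb
    have hiS : i ∉ Sᶜ := by simpa using hi
    calc (m - c + 1) * r = ∑ j ∈ insert i Sᶜ, r := by
            rw [Finset.sum_const, Finset.card_insert_of_notMem hiS, Finset.card_compl,
              Fintype.card_fin, hS, smul_eq_mul]
      _ = ∑ j ∈ insert i Sᶜ, min (a j) r := by
            refine Finset.sum_congr rfl fun j hj => ?_
            rcases Finset.mem_insert.1 hj with rfl | hj
            · omega
            · have := hmin i hi j (by simpa using hj)
              omega
      _ ≤ _ := Finset.sum_le_sum_of_subset (Finset.subset_univ _)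
  · right
    push Not at hb
    have hSne : S.Nonempty := by rw [← Finset.card_pos]; omega
    obtain ⟨x, hx, hmax⟩ := Finset.exists_max_image S a hSne
    have h1 : ∑ i ∈ S, min (a i) r = ∑ i ∈ S, a i :=
      Finset.sum_congr rfl fun j hj => by have := hb j hj; omega
    have h2 : ∑ i ∈ S, a i ≤ c * a x := by
      rw [← hS, ← smul_eq_mul]
      exact Finset.sum_le_card_nsmul _ _ _ hmax
    have h3 : (m - c) * a x ≤ ∑ i ∈ Sᶜ, min (a i) r := by
      have : (m - c) = (Sᶜ).card := by rw [Finset.card_compl, Fintype.card_fin, hS]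
      rw [this, ← smul_eq_mul]
      refine Finset.card_nsmul_le_sum _ _ _ fun j hj => ?_
      have := hmin x hx j (by simpa using hj)
      have := hb x hx
      omega
    have h4 := h S hS
    rw [← Finset.sum_add_sum_compl S, h1]
    obtain ⟨d, rfl⟩ := Nat.exists_eq_add_of_le hcm
    rw [Nat.add_sub_cancel_left] at h3
    nlinarith

theorem total_ge {m c : ℕ} (hc1 : 1 ≤ c) (hcm : c ≤ m) (a : Fin m → ℕ) (s : ℕ)
    (h : ∀ S : Finset (Fin m), S.card = c → s ≤ ∑ i ∈ S, a i) :
    m * s ≤ c * ∑ i, a i := by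
  rcases total_min hc1 hcm a s (m * s) h with h | h
  · have : ∑ i, min (a i) (m * s) ≤ ∑ i, a i := Finset.sum_le_sum fun i _ => min_le_left _ _
    calc m * s ≤ (m - c + 1) * (m * s) := Nat.le_mul_of_pos_left _ (by omega)
      _ ≤ _ := h
      _ ≤ _ := this
      _ ≤ _ := Nat.le_mul_of_pos_left _ (by omega)
  · refine h.trans (Nat.mul_le_mul_left _ (Finset.sum_le_sum fun i _ => min_le_left _ _))

theorem prod_mem {R : Type*} [CommRing R] {m c : ℕ} (f : Fin m → R) (T : Finset (Fin m))
    (hT : m < T.card + c) :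
    ∏ i ∈ T, f i ∈ ⨅ (s : Finset (Fin m)) (_ : s.card = c), Ideal.span (f '' (s : Set (Fin m))) := by
  simp only [Ideal.mem_iInf]
  intro S hS
  have : ¬ Disjoint T S := by
    intro hd
    have := Finset.card_union_of_disjoint hd
    have := Finset.card_le_univ (T ∪ S)
    rw [Fintype.card_fin] at this
    omega
  obtain ⟨i, hi, hiS⟩ := Finset.not_disjoint_iff.1 this
  exact Ideal.mem_of_dvd _ (Finset.dvd_prod_of_mem f hi) (Ideal.subset_span ⟨i, hiS, rfl⟩)

theorem prod_pow_mem {R : Type*} [CommRing R] {m c : ℕ} (hc1 : 1 ≤ c) (hcm : c ≤ m)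
    (f : Fin m → R) (r : ℕ) : ∀ (a : Fin m → ℕ) 
    (_ : (m - c + 1) * r ≤ ∑ i, min (a i) r),
    ∏ i, f i ^ a i ∈
      (⨅ (s : Finset (Fin m)) (_ : s.card = c), Ideal.span (f '' (s : Set (Fin m)))) ^ r := by
  induction r with
  | zero => intro a _; simp
  | succ r ih =>
    intro a ha
    obtain ⟨T, hT, hmax⟩ := exists_largest a (m - c + 1) (by omega)
    have hpos : ∀ i ∈ T, 1 ≤ a i := by
      by_contra! hcon
      obtain ⟨i, hi, hai⟩ := hcon
      have h0 : ∀ j, j ∉ T.erase i → min (a j) (r+1) = 0 := by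
        intro j hj
        by_cases hji : j = i
        · subst hji; omega
        · have := hmax i hi j (fun h => hj (Finset.mem_erase.2 ⟨hji, h⟩))
          omega
      have h1 : ∑ j ∈ T.erase i, min (a j) (r+1) = ∑ j, min (a j) (r+1) :=
        Finset.sum_subset (Finset.subset_univ _) fun j _ hj => h0 j hj
      have h2 : ∑ j ∈ T.erase i, min (a j) (r+1) ≤ (m - c) * (r+1) := by
        have : (T.erase i).card = m - c := by rw [Finset.card_erase_of_mem hi]; omega
        rw [← this, ← smul_eq_mul]
        exact Finset.sum_le_card_nsmul _ _ _ fun j _ => min_le_right _ _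
      rw [h1] at h2
      have := ha.trans h2
      nlinarith
    let a' : Fin m → ℕ := fun i => if i ∈ T then a i - 1 else a i
    have hfac : ∏ i, f i ^ a i = (∏ i, f i ^ a' i) * ∏ i ∈ T, f i := by
      rw [← Finset.prod_mul_prod_compl T, ← Finset.prod_mul_prod_compl T (fun i => f i ^ a' i)]
      have h1 : ∏ i ∈ Tᶜ, f i ^ a' i = ∏ i ∈ Tᶜ, f i ^ a i :=
        Finset.prod_congr rfl fun i hi => by
          have : i ∉ T := by simpa using hi
          simp [a', this]
      have h2 : ∏ i ∈ T, f i ^ a i = (∏ i ∈ T, f i ^ a' i) * ∏ i ∈ T, f i := by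
        rw [← Finset.prod_mul_distrib]
        refine Finset.prod_congr rfl fun i hi => ?_
        have := hpos i hi
        simp only [a', hi, if_true]
        rw [← pow_succ]
        congr 1
        omega
      rw [h1, h2]
      ring
    rw [hfac, pow_succ]
    refine Ideal.mul_mem_mul (ih a' ?_) (prod_mem f T (by omega))
    by_cases hb : ∃ j, j ∉ T ∧ r + 1 ≤ a j
    · obtain ⟨j, hj, hrj⟩ := hb
      calc (m - c + 1) * r = ∑ i ∈ T, r := by rw [Finset.sum_const, hT, smul_eq_mul]
        _ ≤ ∑ i ∈ T, min (a' i) r := by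
            refine Finset.sum_le_sum fun i hi => ?_
            have := hmax i hi j hj
            simp only [a', hi, if_true]
            omega
        _ ≤ _ := Finset.sum_le_sum_of_subset (Finset.subset_univ _)
    · push Not at hb
      have h1 : ∑ i ∈ T, min (a i) (r+1) = ∑ i ∈ T, min (a' i) r + (m - c + 1) := by
        rw [← hT, Finset.card_eq_sum_ones, ← Finset.sum_add_distrib]
        refine Finset.sum_congr rfl fun i hi => ?_
        have := hpos i hi
        simp only [a', hi, if_true]
        omega
      have h2 : ∑ i ∈ Tᶜ, min (a i) (r+1) = ∑ i ∈ Tᶜ, min (a' i) r := by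
        refine Finset.sum_congr rfl fun i hi => ?_
        have hi : i ∉ T := by simpa using hi
        have := hb i hi
        simp only [a', hi, if_false]
        omega
      rw [← Finset.sum_add_sum_compl T] at ha ⊢
      rw [h1, h2] at ha
      rw [mul_add] at ha
      omega

section Sym
variable {R : Type*} [CommRing R] {m c : ℕ}

theorem mul_mem_of {f : Fin m → R} {S : Finset (Fin m)} (hS : S.card = c) {g : R}
    (hg : g ∈ Ideal.span (f '' (S : Set (Fin m)))) :
    (∏ i ∈ Sᶜ, f i) * g ∈
      ⨅ (s : Finset (Fin m)) (_ : s.card = c), Ideal.span (f '' (s : Set (Fin m))) := by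
  induction hg using Submodule.span_induction with
  | mem x hx =>
    obtain ⟨i, hi, rfl⟩ := hx
    have hi' : i ∉ Sᶜ := by simpa using hi
    rw [mul_comm, ← Finset.prod_insert hi']
    apply prod_mem
    rw [Finset.card_insert_of_notMem hi', Finset.card_compl, Fintype.card_fin]
    have := Finset.card_le_univ S
    rw [Fintype.card_fin] at this
    omega
  | zero => simp
  | add x y _ _ hx hy => rw [mul_add]; exact add_mem hx hy
  | smul a x _ hx => rw [smul_eq_mul, mul_left_comm]; exact Ideal.mul_mem_left _ _ hx

theorem symb_eq (f : Fin m → R)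
    (hprime : ∀ S : Finset (Fin m), S.card = c → (Ideal.span (f '' (S : Set (Fin m)))).IsPrime)
    (hne : ∀ S : Finset (Fin m), S.card = c → ∀ i, i ∉ S → f i ∉ Ideal.span (f '' (S : Set (Fin m))))
    (hprimary : ∀ S : Finset (Fin m), S.card = c → ∀ (s : ℕ) (u g : R),
      u ∉ Ideal.span (f '' (S : Set (Fin m))) → u * g ∈ Ideal.span (f '' (S : Set (Fin m))) ^ s →
      g ∈ Ideal.span (f '' (S : Set (Fin m))) ^ s) (s : ℕ) :
    symbolicPower (⨅ (s : Finset (Fin m)) (_ : s.card = c), Ideal.span (f '' (s : Set (Fin m)))) s =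
    ⨅ (S : Finset (Fin m)) (_ : S.card = c), Ideal.span (f '' (S : Set (Fin m))) ^ s := by
  set I := ⨅ (s : Finset (Fin m)) (_ : s.card = c), Ideal.span (f '' (s : Set (Fin m))) with hI
  have hIle : ∀ S : Finset (Fin m), S.card = c → I ≤ Ideal.span (f '' (S : Set (Fin m))) :=
    fun S hS => iInf₂_le S hS
  have hu : ∀ S : Finset (Fin m), S.card = c →
      ∏ i ∈ Sᶜ, f i ∉ Ideal.span (f '' (S : Set (Fin m))) := by
    intro S hS h
    obtain ⟨i, hi, hif⟩ := ((hprime S hS).prod_mem_iff).1 h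
    exact hne S hS i (by simpa using hi) hif
  have hass : ∀ S : Finset (Fin m), S.card = c →
      Ideal.span (f '' (S : Set (Fin m))) ∈ associatedPrimes R (R ⧸ I) := by
    intro S hS
    refine ⟨hprime S hS, Ideal.Quotient.mk I (∏ i ∈ Sᶜ, f i), ?_⟩
    rw [← (hprime S hS).radical]
    congr 1
    ext g
    rw [Submodule.mem_colon_singleton, Submodule.mem_bot, ← Ideal.Quotient.mk_eq_mk,
      ← Submodule.Quotient.mk_smul, Submodule.Quotient.mk_eq_zero, smul_eq_mul]
    constructor
    · intro hg
      rw [mul_comm]; exact mul_mem_of hS hg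
    · intro hg
      exact ((hprime S hS).mem_or_mem (hIle S hS hg)).resolve_right (hu S hS)
  have hass' : ∀ p ∈ associatedPrimes R (R ⧸ I), ∃ S : Finset (Fin m), S.card = c ∧
      p = Ideal.span (f '' (S : Set (Fin m))) := by
    rintro p ⟨hp, x, hx⟩
    obtain ⟨a, rfl⟩ := Ideal.Quotient.mk_surjective x
    have hmem : ∀ g, g ∈ p ↔ ∃ n, g ^ n * a ∈ I := by
      intro g
      rw [hx, Ideal.mem_radical_iff]
      simp only [Submodule.mem_colon_singleton, Submodule.mem_bot, ← Ideal.Quotient.mk_eq_mk,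
        ← Submodule.Quotient.mk_smul, Submodule.Quotient.mk_eq_zero, smul_eq_mul]
    -- some `S` with `a ∉ P_S` and `P_S ≤ p`
    classical
    let A : Finset (Finset (Fin m)) := Finset.univ.filter fun S =>
      S.card = c ∧ a ∉ Ideal.span (f '' (S : Set (Fin m)))
    have hle : A.inf (fun S => Ideal.span (f '' (S : Set (Fin m)))) ≤ p := by
      intro g hg
      rw [hmem]
      refine ⟨1, ?_⟩
      rw [pow_one, hI]
      simp only [Ideal.mem_iInf]
      intro S hS
      by_cases haS : a ∈ Ideal.span (f '' (S : Set (Fin m)))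
      · exact Ideal.mul_mem_left _ _ haS
      · refine Ideal.mul_mem_right _ _ ?_
        exact (Finset.inf_le (f := fun S : Finset (Fin m) => Ideal.span (f '' (S : Set (Fin m))))
          (by simp [A, hS, haS]) : _ ≤ _) hg
    rw [hp.inf_le'] at hle
    obtain ⟨S, hSA, hSp⟩ := hle
    have hSA' : S.card = c ∧ a ∉ Ideal.span (f '' (S : Set (Fin m))) := by simpa [A] using hSA
    refine ⟨S, hSA'.1, le_antisymm ?_ hSp⟩
    intro g hg
    obtain ⟨n, hn⟩ := (hmem g).1 hg
    have hP := hprime S hSA'.1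
    exact hP.mem_of_pow_mem n ((hP.mem_or_mem (hIle S hSA'.1 hn)).resolve_right hSA'.2)
  apply le_antisymm
  · refine le_iInf₂ fun S hS => ?_
    refine (iInf_le _ ⟨_, hass S hS⟩).trans ?_
    intro g hg
    have hP := hprime S hS
    rw [Ideal.mem_comap, IsLocalization.algebraMap_mem_map_algebraMap_iff
      (Ideal.span (f '' (S : Set (Fin m)))).primeCompl] at hg
    obtain ⟨u, hu, hug⟩ := hg
    exact hprimary S hS s u g hu (Ideal.pow_right_mono (hIle S hS) s hug)
  · refine le_iInf ?_
    rintro ⟨p, hp⟩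
    obtain ⟨S, hS, rfl⟩ := hass' p hp
    refine (iInf₂_le S hS).trans ?_
    intro g hg
    have hP := hprime S hS
    rw [Ideal.mem_comap, IsLocalization.algebraMap_mem_map_algebraMap_iff
      (Ideal.span (f '' (S : Set (Fin m)))).primeCompl]
    refine ⟨(∏ i ∈ Sᶜ, f i) ^ s, ?_, ?_⟩
    · exact fun h => hu S hS (hP.mem_of_pow_mem _ h)
    · have h1 : Ideal.span {∏ i ∈ Sᶜ, f i} * Ideal.span (f '' (S : Set (Fin m))) ≤ I := by
        rw [Ideal.span_singleton_mul_le_iff]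
        intro z hz
        exact mul_mem_of hS hz
      have h2 := Ideal.pow_right_mono h1 s
      rw [mul_pow, Ideal.span_singleton_pow] at h2
      exact h2 (Ideal.mul_mem_mul (Ideal.mem_span_singleton_self _) hg)
end Sym

section Poly
variable {K : Type*} [Field K] {m : ℕ} {κ : Type*}

/-- The ideal generated by the variables in `S`. -/
noncomputable def Q (K : Type*) [Field K] {m : ℕ} (κ : Type*) (S : Finset (Fin m)) :
    Ideal (MvPolynomial (Fin m ⊕ κ) K) :=
  Ideal.span ((fun i => X (Sum.inl i)) '' (S : Set (Fin m)))

/-- The `S`-degree of a monomial. -/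
def degS (S : Finset (Fin m)) (a : (Fin m ⊕ κ) →₀ ℕ) : ℕ := ∑ i ∈ S, a (Sum.inl i)

open Classical in
/-- The substitution scaling the variables in `S` by a new variable. -/
noncomputable def phi (K : Type*) [Field K] {m : ℕ} (κ : Type*) (S : Finset (Fin m)) :
    MvPolynomial (Fin m ⊕ κ) K →ₐ[K] Polynomial (MvPolynomial (Fin m ⊕ κ) K) :=
  aeval (fun j => Polynomial.C (X j) *
    Polynomial.X ^ (degS S (Finsupp.single j 1)))

theorem degS_add (S : Finset (Fin m)) (a b : (Fin m ⊕ κ) →₀ ℕ) :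
    degS S (a + b) = degS S a + degS S b := by
  simp [degS, Finset.sum_add_distrib]

theorem degS_smul (S : Finset (Fin m)) (n : ℕ) (b : (Fin m ⊕ κ) →₀ ℕ) :
    degS S (n • b) = n * degS S b := by
  simp [degS, Finset.mul_sum]

theorem phi_monomial (S : Finset (Fin m)) (a : (Fin m ⊕ κ) →₀ ℕ) (r : K) :
    phi K κ S (monomial a r) = Polynomial.C (monomial a r) * Polynomial.X ^ degS S a := by
  have key : ∀ a : (Fin m ⊕ κ) →₀ ℕ, phi K κ S (monomial a 1) =
      Polynomial.C (monomial a 1) * Polynomial.X ^ degS S a := by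
    intro a
    induction a using Finsupp.induction_linear with
    | zero => simp [degS]
    | add a b ha hb =>
      have h : (monomial (a + b) (1:K)) = monomial a 1 * monomial b 1 := by simp
      rw [h, map_mul, ha, hb, degS_add, map_mul]
      ring
    | single j n =>
      have h : (monomial (Finsupp.single j n) (1:K)) = X j ^ n := by
        rw [X_pow_eq_monomial]
      have h2 : Finsupp.single j n = n • Finsupp.single j 1 := by simp
      rw [h, map_pow, phi, aeval_X, mul_pow, h2, degS_smul, map_pow, ← pow_mul]
      ring
  have h : monomial a r = r • monomial a (1 : K) := by simp [smul_monomial]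
  rw [h, map_smul, key, ← smul_mul_assoc]
  rw [Polynomial.smul_C]

theorem coeff_phi (S : Finset (Fin m)) (g : MvPolynomial (Fin m ⊕ κ) K)
    (a : (Fin m ⊕ κ) →₀ ℕ) (k : ℕ) :
    coeff a ((phi K κ S g).coeff k) = if degS S a = k then coeff a g else 0 := by
  classical
  induction g using MvPolynomial.induction_on' with
  | monomial u r =>
    rw [phi_monomial, Polynomial.coeff_C_mul, Polynomial.coeff_X_pow, coeff_monomial]
    by_cases hk : k = degS S u
    · by_cases hu : u = a
      · subst hu; simp [hk]
      · simp [hk, hu, coeff_monomial]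
    · by_cases hu : u = a
      · subst hu; simp [hk, Ne.symm hk]
      · simp [hk, hu]
  | add p q hp hq =>
    rw [map_add, Polynomial.coeff_add, coeff_add, hp, hq, coeff_add]
    split_ifs <;> simp

theorem dvd_phi_iff (S : Finset (Fin m)) (g : MvPolynomial (Fin m ⊕ κ) K) (s : ℕ) :
    Polynomial.X ^ s ∣ phi K κ S g ↔ ∀ a ∈ g.support, s ≤ degS S a := by
  rw [Polynomial.X_pow_dvd_iff]
  constructor
  · intro h a ha
    by_contra hlt
    push Not at hlt
    have := coeff_phi S g a (degS S a)
    rw [h _ hlt] at this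
    simp only [coeff_zero, if_true] at this
    exact (mem_support_iff.1 ha) this.symm
  · intro h d hd
    ext a
    rw [coeff_phi, coeff_zero]
    split_ifs with hda
    · by_contra hne
      have := h a (mem_support_iff.2 hne)
      omega
    · rfl

theorem mem_Q_pow (S : Finset (Fin m)) (g : MvPolynomial (Fin m ⊕ κ) K) (s : ℕ) :
    g ∈ Q K κ S ^ s ↔ ∀ a ∈ g.support, s ≤ degS S a := by
  classical
  constructor
  · intro hg
    rw [← dvd_phi_iff, ← Ideal.mem_span_singleton]
    have h1 : (Q K κ S).map (phi K κ S) ≤ Ideal.span {Polynomial.X} := by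
      rw [Q, Ideal.map_span, Ideal.span_le]
      rintro _ ⟨_, ⟨i, hi, rfl⟩, rfl⟩
      rw [SetLike.mem_coe, Ideal.mem_span_singleton]
      have h := (dvd_phi_iff (κ := κ) (K := K) S (X (Sum.inl i)) 1).2 (by
        intro a ha
        rw [support_X, Finset.mem_singleton] at ha
        subst ha
        refine le_trans ?_ (Finset.single_le_sum (fun _ _ => Nat.zero_le _) hi)
        simp)
      simpa using h
    have h2 := Ideal.pow_right_mono h1 s
    rw [← Ideal.map_pow, Ideal.span_singleton_pow] at h2
    exact h2 (Ideal.mem_map_of_mem _ hg)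
  · intro h
    rw [g.as_sum]
    refine Ideal.sum_mem _ fun a ha => ?_
    refine Ideal.pow_le_pow_right (h a ha) ?_
    have hd : (∏ i ∈ S, X (Sum.inl i) ^ a (Sum.inl i) : MvPolynomial (Fin m ⊕ κ) K) ∣
        monomial a (coeff a g) := by
      have h3 : (∏ i ∈ S, X (Sum.inl i) ^ a (Sum.inl i) : MvPolynomial (Fin m ⊕ κ) K) =
          monomial (∑ i ∈ S, Finsupp.single (Sum.inl i) (a (Sum.inl i))) 1 := by
        rw [monomial_sum_one]
        simp [X_pow_eq_monomial]
      rw [h3, monomial_dvd_monomial]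
      refine ⟨Or.inr ?_, one_dvd _⟩
      intro j
      rw [Finsupp.finsetSum_apply]
      rcases j with j | j
      · by_cases hj : j ∈ S
        · rw [Finset.sum_eq_single j]
          · simp
          · intro b _ hb
            simp [Finsupp.single_apply, hb]
          · exact fun h => absurd hj h
        · rw [Finset.sum_eq_zero]
          · exact Nat.zero_le _
          · intro b hb
            have : b ≠ j := fun h => hj (h ▸ hb)
            simp [Finsupp.single_apply, this]
      · simp [Finsupp.single_apply]
    refine Ideal.mem_of_dvd _ hd ?_
    rw [degS, ← Finset.prod_pow_eq_pow_sum]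
    refine Ideal.prod_mem_prod fun i hi => ?_
    have hX : (X (Sum.inl i) : MvPolynomial (Fin m ⊕ κ) K) ∈ Q K κ S :=
      Ideal.subset_span ⟨i, hi, rfl⟩
    exact Ideal.pow_mem_pow hX _

theorem mem_Q (S : Finset (Fin m)) (g : MvPolynomial (Fin m ⊕ κ) K) :
    g ∈ Q K κ S ↔ ∀ a ∈ g.support, 1 ≤ degS S a := by
  rw [← mem_Q_pow, pow_one]

theorem mem_Q_pow' (S : Finset (Fin m)) (g : MvPolynomial (Fin m ⊕ κ) K) (s : ℕ) :
    g ∈ Q K κ S ^ s ↔ Polynomial.X ^ s ∣ phi K κ S g := by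
  rw [mem_Q_pow, dvd_phi_iff]

theorem mem_Q' (S : Finset (Fin m)) (g : MvPolynomial (Fin m ⊕ κ) K) :
    g ∈ Q K κ S ↔ Polynomial.X ∣ phi K κ S g := by
  rw [mem_Q, ← dvd_phi_iff, pow_one]

theorem Q_prime (S : Finset (Fin m)) : (Q K κ S).IsPrime := by
  constructor
  · rw [Ideal.ne_top_iff_one, mem_Q', map_one]
    exact fun h => Polynomial.not_isUnit_X (isUnit_of_dvd_one h)
  · intro x y h
    rw [mem_Q', map_mul] at h
    rw [mem_Q', mem_Q']
    exact Polynomial.prime_X.dvd_or_dvd h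

theorem Q_primary (S : Finset (Fin m)) (s : ℕ) (u g : MvPolynomial (Fin m ⊕ κ) K)
    (hu : u ∉ Q K κ S) (h : u * g ∈ Q K κ S ^ s) : g ∈ Q K κ S ^ s := by
  rw [mem_Q_pow', map_mul] at h
  rw [mem_Q'] at hu
  rw [mem_Q_pow']
  exact Polynomial.prime_X.pow_dvd_of_dvd_mul_left s hu h

theorem X_notMem (S : Finset (Fin m)) (i : Fin m) (hi : i ∉ S) :
    (X (Sum.inl i) : MvPolynomial (Fin m ⊕ κ) K) ∉ Q K κ S := by
  rw [mem_Q]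
  intro h
  have := h (Finsupp.single (Sum.inl i) 1) (by simp [support_X])
  rw [degS, Finset.sum_eq_zero] at this
  · omega
  · intro j hj
    have : i ≠ j := fun h => hi (h ▸ hj)
    simp [Finsupp.single_apply, this]

/-- The monomial star configuration ideal. -/
noncomputable def Ix (K : Type*) [Field K] (m c : ℕ) (κ : Type*) :
    Ideal (MvPolynomial (Fin m ⊕ κ) K) :=
  ⨅ (s : Finset (Fin m)) (_ : s.card = c), Q K κ s

theorem Ix_le {c : ℕ} (hc1 : 1 ≤ c) (hcm : c ≤ m) :
    Ix K m c κ ≤ Q K κ (Finset.univ : Finset (Fin m)) ^ (m - c + 1) := by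
  intro g hg
  rw [mem_Q_pow]
  intro a ha
  simp only [Ix, Ideal.mem_iInf, mem_Q] at hg
  rcases total_min hc1 hcm (fun i => a (Sum.inl i)) 1 1 (fun S hS => hg S hS a ha) with h | h
  · rw [mul_one] at h
    exact h.trans (Finset.sum_le_sum fun i _ => min_le_left _ _)
  · by_contra hlt
    push Not at hlt
    -- the set of zero entries has at least `c` elements
    let Z : Finset (Fin m) := Finset.univ.filter fun i => a (Sum.inl i) = 0
    have hZ : (Zᶜ).card ≤ degS Finset.univ a := by
      rw [Finset.card_eq_sum_ones]
      refine le_trans (Finset.sum_le_sum fun i hi => ?_)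
        (Finset.sum_le_sum_of_subset (Finset.subset_univ _))
      have : a (Sum.inl i) ≠ 0 := by simpa [Z] using hi
      omega
    rw [Finset.card_compl, Fintype.card_fin] at hZ
    obtain ⟨S, hSZ, hS⟩ := Finset.exists_subset_card_eq (s := Z) (n := c) (by omega)
    have := hg S hS a ha
    rw [degS, Finset.sum_eq_zero] at this
    · omega
    · intro i hi
      simpa [Z] using hSZ hi

theorem Ix_pow_le {c : ℕ} (hc1 : 1 ≤ c) (hcm : c ≤ m) (r : ℕ) :
    Ix K m c κ ^ r ≤ Q K κ (Finset.univ : Finset (Fin m)) ^ ((m - c + 1) * r) := by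
  rw [pow_mul]
  exact Ideal.pow_right_mono (Ix_le hc1 hcm) r

theorem prodX_eq (a : Fin m → ℕ) : (∏ i, X (Sum.inl i) ^ a i : MvPolynomial (Fin m ⊕ κ) K) =
          monomial (∑ i, Finsupp.single (Sum.inl i) (a i)) 1 := by
  rw [monomial_sum_one]
  simp [X_pow_eq_monomial]

theorem contain {c : ℕ} (hc1 : 1 ≤ c) (hcm : c ≤ m) (s r : ℕ)
    (hsr : r * (c * (m - c + 1)) ≤ s * m) :
    ⨅ (S : Finset (Fin m)) (_ : S.card = c), Q K κ S ^ s ≤ Ix K m c κ ^ r := by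
  intro g hg
  simp only [Ideal.mem_iInf, mem_Q_pow] at hg
  rw [g.as_sum]
  refine Ideal.sum_mem _ fun a ha => ?_
  have h1 : (m - c + 1) * r ≤ ∑ i, min (a (Sum.inl i)) r := by
    rcases total_min hc1 hcm (fun i => a (Sum.inl i)) s r (fun S hS => hg S hS a ha) with h | h
    · exact h
    · have : c * ((m - c + 1) * r) ≤ c * ∑ i, min (a (Sum.inl i)) r := by
        refine le_trans ?_ h
        linarith
      exact Nat.le_of_mul_le_mul_left this (by omega)
  have h2 := prod_pow_mem hc1 hcm (fun i => (X (Sum.inl i) : MvPolynomial (Fin m ⊕ κ) K)) r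
    (fun i => a (Sum.inl i)) h1
  refine Ideal.mem_of_dvd _ ?_ h2
  rw [prodX_eq, monomial_dvd_monomial]
  refine ⟨Or.inr ?_, one_dvd _⟩
  intro j
  rw [Finsupp.finsetSum_apply]
  rcases j with j | j
  · rw [Finset.sum_eq_single j]
    · simp
    · intro b _ hb
      simp [Finsupp.single_apply, hb]
    · simp
  · simp [Finsupp.single_apply]

theorem degS_le_degree [DecidableEq κ] (a : (Fin m ⊕ κ) →₀ ℕ) :
    degS Finset.univ a ≤ a.degree := by
  classical
  have h : degS Finset.univ a = ∑ j ∈ Finset.univ.map ⟨Sum.inl, Sum.inl_injective⟩, a j := by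
    simp [degS]
  rw [h, Finsupp.degree_apply]
  refine Finset.sum_le_sum_of_ne_zero fun x _ hx => Finsupp.mem_support_iff.2 hx

end Poly

universe u

section Coord
variable {K : Type*} [Field K]

theorem notMem_prev {R : Type*} [CommRing R] {m : ℕ} (f : Fin m → R)
    (hreg : RingTheory.Sequence.IsRegular R (List.ofFn f)) (i : Fin m) :
    f i ∉ Ideal.span (f '' Set.Iio i) := by
  intro hi
  have hlen : (i : ℕ) < (List.ofFn f).length := by simp
  have h := hreg.regular_mod_prev i hlen
  have hget : (List.ofFn f)[(i : ℕ)] = f i := by simp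
  rw [hget] at h
  have hle : Ideal.span (f '' Set.Iio i) ≤ Ideal.ofList ((List.ofFn f).take i) := by
    rw [Ideal.span_le]
    rintro _ ⟨j, hj, rfl⟩
    refine Ideal.subset_span ?_
    have hj' : (j : ℕ) < i := hj
    change f j ∈ (List.ofFn f).take i
    rw [List.mem_take_iff_getElem]
    refine ⟨j, by simp; omega, by simp⟩
  have hi' := hle hi
  have hle2 : Ideal.ofList ((List.ofFn f).take i) ≤ Ideal.ofList (List.ofFn f) :=
    Ideal.span_mono fun x hx => List.mem_of_mem_take hx
  have h1 : (1 : R) ∈ Ideal.ofList ((List.ofFn f).take i) := by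
    have h0 : f i • (Submodule.Quotient.mk (1 : R) :
        R ⧸ (Ideal.ofList ((List.ofFn f).take i) • ⊤ : Submodule R R)) = f i • 0 := by
      rw [smul_zero, ← Submodule.Quotient.mk_smul, Submodule.Quotient.mk_eq_zero]
      simpa using hi'
    have := h h0
    rw [Submodule.Quotient.mk_eq_zero] at this
    simpa using this
  apply hreg.top_ne_smul
  rw [eq_comm, smul_eq_mul, Ideal.mul_top, Ideal.eq_top_iff_one]
  exact hle2 h1

theorem linInd {A : Type*} [CommRing A] [Algebra K A] {m : ℕ} (f : Fin m → A)
    (hreg : RingTheory.Sequence.IsRegular A (List.ofFn f)) : LinearIndependent K f := by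
  classical
  rw [Fintype.linearIndependent_iff]
  intro g hg
  by_contra! hcon
  have hne : (Finset.univ.filter fun i => g i ≠ 0).Nonempty := by
    obtain ⟨i, hi⟩ := hcon
    exact ⟨i, by simpa using hi⟩
  obtain ⟨i, hi, hmax⟩ := Finset.exists_max_image _ id hne
  have hgi : g i ≠ 0 := by simpa using hi
  apply notMem_prev f hreg i
  have hz : ∀ j, i < j → g j = 0 := by
    intro j hj
    by_contra h
    exact absurd (hmax j (by simpa using h)) (not_le.2 hj)
  have hs : g i • f i ∈ Ideal.span (f '' Set.Iio i) := by
    have : g i • f i = - ∑ j ∈ Finset.univ.erase i, g j • f j := by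
      rw [eq_neg_iff_add_eq_zero, Finset.add_sum_erase _ (fun j => g j • f j) (Finset.mem_univ i)]
      exact hg
    rw [this]
    refine neg_mem (Ideal.sum_mem _ fun j hj => ?_)
    rcases lt_trichotomy j i with h | h | h
    · rw [Algebra.smul_def]
      exact Ideal.mul_mem_left _ _ (Ideal.subset_span ⟨j, h, rfl⟩)
    · exact absurd h (Finset.ne_of_mem_erase hj)
    · rw [hz j h, zero_smul]; exact zero_mem _
  have : f i = algebraMap K A (g i)⁻¹ * (g i • f i) := by
    rw [← Algebra.smul_def, smul_smul, inv_mul_cancel₀ hgi, one_smul]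
  rw [this]
  exact Ideal.mul_mem_left _ _ hs

theorem exists_coord {K : Type u} [Field K] {σ : Type} {m : ℕ} (f : Fin m → MvPolynomial σ K)
    (hlin : ∀ i, (f i).IsHomogeneous 1) (hf : LinearIndependent K f) :
    ∃ (κ : Type u) (e : MvPolynomial (Fin m ⊕ κ) K ≃ₐ[K] MvPolynomial σ K),
      (∀ i, e (X (Sum.inl i)) = f i) ∧
      ∀ g d, g.IsHomogeneous d → (e.symm g).IsHomogeneous d := by
  let L : (σ →₀ K) →ₗ[K] MvPolynomial σ K := Finsupp.linearCombination K X
  have hL : ∀ i, ∃ v, L v = f i := by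
    intro i
    have : f i ∈ homogeneousSubmodule σ K 1 := hlin i
    rw [homogeneousSubmodule_one_eq_span_X, Finsupp.mem_span_range_iff_exists_finsupp] at this
    obtain ⟨v, hv⟩ := this
    exact ⟨v, by rw [← hv]; rfl⟩
  choose v hv using hL
  have hvi : LinearIndependent K v := by
    apply LinearIndependent.of_comp L
    have : L ∘ v = f := funext hv
    rwa [this]
  let b := Module.Basis.sumExtend hvi
  have hb : ∀ i, b (Sum.inl i) = v i := by
    intro i
    simp [b, Module.Basis.sumExtend]
    rfl
  let κ := Module.Basis.sumExtendIndex hvi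
  let L' : ((Fin m ⊕ κ) →₀ K) →ₗ[K] MvPolynomial (Fin m ⊕ κ) K := Finsupp.linearCombination K X
  let φ : MvPolynomial (Fin m ⊕ κ) K →ₐ[K] MvPolynomial σ K := aeval fun j => L (b j)
  let ψ : MvPolynomial σ K →ₐ[K] MvPolynomial (Fin m ⊕ κ) K :=
    aeval fun l => L' (b.repr (Finsupp.single l 1))
  have h1 : ∀ w, φ (L' w) = L (b.repr.symm w) := by
    intro w
    have : φ.toLinearMap ∘ₗ L' = L ∘ₗ b.repr.symm.toLinearMap := by
      ext j
      simp [φ, L']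
    exact LinearMap.congr_fun this w
  have h2 : ∀ w, ψ (L w) = L' (b.repr w) := by
    intro w
    have : ψ.toLinearMap ∘ₗ L = L' ∘ₗ b.repr.toLinearMap := by
      ext j
      simp [ψ, L]
    exact LinearMap.congr_fun this w
  let e : MvPolynomial (Fin m ⊕ κ) K ≃ₐ[K] MvPolynomial σ K := AlgEquiv.ofAlgHom φ ψ
    (by
      ext1 l
      simp only [AlgHom.comp_apply, AlgHom.id_apply]
      have : ψ (X l) = L' (b.repr (Finsupp.single l 1)) := by simp [ψ]
      rw [this, h1]
      simp [L])
    (by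
      ext1 j
      simp only [AlgHom.comp_apply, AlgHom.id_apply]
      have : φ (X j) = L (b j) := by simp [φ]
      rw [this, h2]
      simp [L'])
  refine ⟨κ, e, ?_, ?_⟩
  · intro i
    have : e (X (Sum.inl i)) = φ (X (Sum.inl i)) := rfl
    rw [this, ← hv i, ← hb i]
    simp [φ]
  · intro g d hg
    have : e.symm g = ψ g := rfl
    rw [this]
    have := hg.aeval (fun l => L' (b.repr (Finsupp.single l 1))) (n := 1) ?_
    · rwa [one_mul] at this
    · intro l
      simp only [L', Finsupp.linearCombination_apply, Finsupp.sum]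
      refine IsHomogeneous.sum _ _ _ fun j _ => ?_
      rw [smul_eq_C_mul]
      exact (isHomogeneous_X K j).C_mul _
end Coord

theorem main_aux {n : ℕ} {K : Type u} [Field K]
    (m c : ℕ) (hc1 : 1 ≤ c) (hcm : c ≤ m)
    (f : Fin m → MvPolynomial (Fin (n + 1)) K)
    (hlin : ∀ i, MvPolynomial.IsHomogeneous (f i) 1)
    (hreg : RingTheory.Sequence.IsRegular (MvPolynomial (Fin (n + 1)) K) (List.ofFn f))
    (I : Ideal (MvPolynomial (Fin (n + 1)) K))
    (hI : I = ⨅ (s : Finset (Fin m)) (_ : s.card = c), Ideal.span (f '' (s : Set (Fin m)))) :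
    -- containment
    (∀ s r : ℕ, r * (c * (m - c + 1)) ≤ s * m → symbolicPower I s ≤ I ^ r) ∧
    -- special elements
    (∀ s k : ℕ, s ≤ c * k → (∏ i, f i) ^ k ∈ symbolicPower I s) ∧
    (∀ r k : ℕ, m * k < (m - c + 1) * r → (∏ i, f i) ^ k ∉ I ^ r) ∧
    -- degree bounds
    (∀ (s d : ℕ) (g : MvPolynomial (Fin (n + 1)) K), g ∈ symbolicPower I s → g ≠ 0 →
      g.IsHomogeneous d → m * s ≤ c * d) ∧
    (∀ (d : ℕ) (g : MvPolynomial (Fin (n + 1)) K), g ∈ I → g ≠ 0 →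
      g.IsHomogeneous d → m - c + 1 ≤ d) ∧ (∀ i, f i ≠ 0) := by
  classical
  have hli : LinearIndependent K f := linInd f hreg
  obtain ⟨κ, e, he, hhom⟩ := exists_coord f hlin hli
  have hP : ∀ S : Finset (Fin m), Ideal.span (f '' (S : Set (Fin m))) =
      (Q K κ S).map (e : _ →+* MvPolynomial (Fin (n + 1)) K) := by
    intro S
    rw [Q, Ideal.map_span, Set.image_image]
    congr 2
    funext i
    exact (he i).symm
  have hmap : ∀ (J : Ideal (MvPolynomial (Fin m ⊕ κ) K)) (g : MvPolynomial (Fin (n + 1)) K),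
      g ∈ J.map (e : _ →+* MvPolynomial (Fin (n + 1)) K) ↔ e.symm g ∈ J := by
    intro J g
    have := Ideal.mem_map_of_equiv e (I := J) g
    refine this.trans ⟨?_, fun h => ⟨_, h, e.apply_symm_apply g⟩⟩
    rintro ⟨x, hx, rfl⟩
    rwa [e.symm_apply_apply]
  have hPs : ∀ (S : Finset (Fin m)) (s : ℕ) (g : MvPolynomial (Fin (n + 1)) K),
      g ∈ Ideal.span (f '' (S : Set (Fin m))) ^ s ↔ e.symm g ∈ Q K κ S ^ s := by
    intro S s g
    rw [hP, ← Ideal.map_pow, hmap]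
  have hP1 : ∀ (S : Finset (Fin m)) (g : MvPolynomial (Fin (n + 1)) K),
      g ∈ Ideal.span (f '' (S : Set (Fin m))) ↔ e.symm g ∈ Q K κ S := by
    intro S g
    rw [hP, hmap]
  have hIx : I = (Ix K m c κ).map (e : _ →+* MvPolynomial (Fin (n + 1)) K) := by
    ext g
    rw [hmap, hI, Ix]
    simp only [Ideal.mem_iInf, hP1]
  have hIr : ∀ (r : ℕ) (g : MvPolynomial (Fin (n + 1)) K),
      g ∈ I ^ r ↔ e.symm g ∈ Ix K m c κ ^ r := by
    intro r g
    rw [hIx, ← Ideal.map_pow, hmap]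
  have hes : ∀ i, e.symm (f i) = X (Sum.inl i) := fun i => by rw [← he, e.symm_apply_apply]
  have hsym : ∀ s, symbolicPower I s =
      ⨅ (S : Finset (Fin m)) (_ : S.card = c), Ideal.span (f '' (S : Set (Fin m))) ^ s := by
    intro s
    rw [hI]
    apply symb_eq
    · intro S _
      have hQ : (Q K κ S).IsPrime := Q_prime S
      constructor
      · rw [Ideal.ne_top_iff_one, hP1, map_one]
        exact (Ideal.ne_top_iff_one _).1 hQ.ne_top
      · intro x y h
        rw [hP1, map_mul] at h
        rw [hP1, hP1]
        exact hQ.mem_or_mem h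
    · intro S _ i hi
      rw [hP1, hes]
      exact X_notMem S i hi
    · intro S _ s u g hu h
      rw [hPs, map_mul] at h
      rw [hP1] at hu
      rw [hPs]
      exact Q_primary S s _ _ hu h
  have hsm : ∀ s g, g ∈ symbolicPower I s ↔ e.symm g ∈
      ⨅ (S : Finset (Fin m)) (_ : S.card = c), Q K κ S ^ s := by
    intro s g
    rw [hsym]
    simp only [Ideal.mem_iInf, hPs]
  have hprod : ∀ k, e.symm ((∏ i, f i) ^ k) =
      monomial (∑ i, Finsupp.single (Sum.inl i) k) 1 := by
    intro k
    rw [← prodX_eq (fun _ => k), map_pow, map_prod, ← Finset.prod_pow]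
    simp only [hes]
  have hdeg : ∀ (S : Finset (Fin m)) k, degS (κ := κ) S
      (∑ i, Finsupp.single (Sum.inl i) k) = S.card * k := by
    intro S k
    rw [degS, ← smul_eq_mul, ← Finset.sum_const]
    refine Finset.sum_congr rfl fun j _ => ?_
    rw [Finsupp.finsetSum_apply, Finset.sum_eq_single j]
    · simp
    · intro b _ hb
      simp [hb]
    · simp
  refine ⟨?_, ?_, ?_, ?_, ?_, fun i => hli.ne_zero i⟩
  · intro s r hsr g hg
    rw [hIr]
    rw [hsm] at hg
    exact contain hc1 hcm s r hsr hg
  · intro s k hsk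
    rw [hsm, hprod]
    simp only [Ideal.mem_iInf, mem_Q_pow]
    intro S hS a ha
    rw [support_monomial, if_neg one_ne_zero, Finset.mem_singleton] at ha
    rw [ha, hdeg, hS]
    exact hsk
  · intro r k hk h
    rw [hIr, hprod] at h
    have h := (mem_Q_pow _ _ _).1 (Ix_pow_le hc1 hcm r h) _
      (by rw [support_monomial, if_neg one_ne_zero]; exact Finset.mem_singleton_self _)
    rw [hdeg, Finset.card_univ, Fintype.card_fin] at h
    omega
  · intro s d g hg hg0 hgd
    rw [hsm] at hg
    have h0 : e.symm g ≠ 0 := by simpa using hg0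
    obtain ⟨a, ha⟩ := (support_nonempty).2 h0
    simp only [Ideal.mem_iInf, mem_Q_pow] at hg
    have h1 := total_ge hc1 hcm (fun i => a (Sum.inl i)) s (fun S hS => hg S hS a ha)
    have h2 := degS_le_degree a
    have h3 : a.degree = d := by
      have := hhom g d hgd (mem_support_iff.1 ha)
      rwa [Finsupp.degree_eq_weight_one]
    rw [h3] at h2
    exact h1.trans (Nat.mul_le_mul_left _ h2)
  · intro d g hg hg0 hgd
    rw [← pow_one I, hIr, pow_one] at hg
    have h0 : e.symm g ≠ 0 := by simpa using hg0
    obtain ⟨a, ha⟩ := (support_nonempty).2 h0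
    have h1 := (mem_Q_pow _ _ _).1 (Ix_le hc1 hcm hg) a ha
    have h2 := degS_le_degree a
    have h3 : a.degree = d := by
      have := hhom g d hgd (mem_support_iff.1 ha)
      rwa [Finsupp.degree_eq_weight_one]
    omega

theorem tendsto_aux (c d m : ℕ) (hm : 0 < m) :
    Tendsto (fun k : ℕ => ((c * d * (k + 1) : ℕ) : ℝ) / ((m * (k + 1) + 1 : ℕ) : ℝ)) atTop
      (nhds ((c * d : ℕ) / (m : ℝ))) := by
  have hm' : (m : ℝ) ≠ 0 := by positivity
  have h1 : Tendsto (fun k : ℕ => 1 / ((k : ℝ) + 1)) atTop (nhds 0) :=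
    tendsto_one_div_add_atTop_nhds_zero_nat
  have h2 : Tendsto (fun k : ℕ => ((c * d : ℕ) : ℝ) / (m + 1 / ((k : ℝ) + 1))) atTop
      (nhds ((c * d : ℕ) / ((m : ℝ) + 0))) :=
    Tendsto.div tendsto_const_nhds (tendsto_const_nhds.add h1) (by simpa using hm')
  rw [add_zero] at h2
  refine h2.congr fun k => ?_
  have : (k : ℝ) + 1 ≠ 0 := by positivity
  have : (m : ℝ) * (k + 1) + 1 ≠ 0 := by positivity
  push_cast
  field_simp

theorem sup_aux (A : Set ℝ) (c d m : ℕ) (hm : 0 < m)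
    (hub : ∀ x ∈ A, x ≤ (c * d : ℕ) / (m : ℝ))
    (hmem : ∀ k : ℕ, ((c * d * (k + 1) : ℕ) : ℝ) / ((m * (k + 1) + 1 : ℕ) : ℝ) ∈ A) :
    sSup A = (c * d : ℕ) / (m : ℝ) := by
  apply le_antisymm
  · exact csSup_le ⟨_, hmem 0⟩ hub
  · exact le_of_tendsto (tendsto_aux c d m hm)
      (Eventually.of_forall fun k => le_csSup ⟨_, hub⟩ (hmem k))

theorem div_le_aux {s r c d m : ℕ} (hr : 0 < r) (hm : 0 < m)
    (h : ¬ r * (c * d) ≤ s * m) : (s : ℝ) / r ≤ (c * d : ℕ) / (m : ℝ) := by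
  rw [div_le_div_iff₀ (by positivity) (by positivity)]
  have : s * m ≤ (c * d) * r := by
    rw [mul_comm (c * d)]; omega
  exact_mod_cast this

end StarConf

theorem star_configuration_resurgence {n : ℕ} {K : Type*} [Field K] [CharZero K]
    (m c : ℕ) (hc1 : 1 ≤ c) (hcm : c ≤ m)
    (f : Fin m → MvPolynomial (Fin (n + 1)) K)
    (hlin : ∀ i, MvPolynomial.IsHomogeneous (f i) 1)
    (hreg : RingTheory.Sequence.IsRegular (MvPolynomial (Fin (n + 1)) K) (List.ofFn f)) :
    let I : Ideal (MvPolynomial (Fin (n + 1)) K) :=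
      ⨅ (s : Finset (Fin m)) (_ : s.card = c), Ideal.span (f '' ↑s)
    resurgence I = (c * (m - c + 1) : ℕ) / (m : ℝ) ∧
    asympResurgence I = (c * (m - c + 1) : ℕ) / (m : ℝ) ∧
    ∃ W : ℝ, Tendsto (fun s : ℕ => (alphaDeg (symbolicPower I s) : ℝ) / s) atTop (nhds W) ∧
      (alphaDeg I : ℝ) / W = (c * (m - c + 1) : ℕ) / (m : ℝ) := by
  intro I
  obtain ⟨hcon, hel, hnel, hdeg, hdegI, hf0⟩ :=
    StarConf.main_aux m c hc1 hcm f hlin hreg I rfl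
  have hm : 0 < m := by omega
  have hhomT : ∀ T : Finset (Fin m), (∏ i ∈ T, f i).IsHomogeneous T.card := by
    intro T
    have := IsHomogeneous.prod T f (fun _ => 1) (fun i _ => hlin i)
    simpa using this
  have hhomk : ∀ k, ((∏ i, f i) ^ k).IsHomogeneous (m * k) := by
    intro k
    have := (hhomT Finset.univ).pow k
    simpa using this
  have hprod0 : ∀ T : Finset (Fin m), ∏ i ∈ T, f i ≠ 0 := fun T =>
    Finset.prod_ne_zero_iff.2 fun i _ => hf0 i
  have hnot : ∀ k T : ℕ, 0 < T →
      ¬ symbolicPower I (c * (m - c + 1) * (k + 1) * T) ≤ I ^ ((m * (k + 1) + 1) * T) := by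
    intro k T hT hle
    refine hnel ((m * (k + 1) + 1) * T) ((m - c + 1) * (k + 1) * T) ?_
      (hle (hel _ _ (le_of_eq (by ring))))
    have : 0 < (m - c + 1) * T := by positivity
    calc _ < m * ((m - c + 1) * (k + 1) * T) + (m - c + 1) * T := by omega
      _ = _ := by ring
  refine ⟨?_, ?_, (m : ℝ) / c, ?_, ?_⟩
  · refine StarConf.sup_aux _ c (m - c + 1) m hm ?_ ?_
    · rintro x ⟨s, r, hs, hr, rfl, h⟩
      exact StarConf.div_le_aux hr hm fun hle => h (hcon s r hle)
    · intro k
      refine ⟨_, _, by positivity, by positivity, rfl, ?_⟩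
      simpa using hnot k 1 one_pos
  · refine StarConf.sup_aux _ c (m - c + 1) m hm ?_ ?_
    · rintro x ⟨s, r, hs, hr, rfl, h⟩
      refine StarConf.div_le_aux hr hm fun hle => ?_
      obtain ⟨T, hT⟩ := h.exists
      apply hT
      apply hcon
      calc r * T * (c * (m - c + 1)) = T * (r * (c * (m - c + 1))) := by ring
        _ ≤ T * (s * m) := Nat.mul_le_mul_left _ hle
        _ = _ := by ring
    · intro k
      refine ⟨_, _, by positivity, by positivity, rfl, ?_⟩
      filter_upwards [eventually_gt_atTop 0] with T hT
      exact hnot k T hT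
  · have hlow : ∀ s, m * s ≤ c * alphaDeg (symbolicPower I s) := by
      intro s
      have hne : {d | ∃ f ∈ symbolicPower I s, f ≠ 0 ∧ MvPolynomial.IsHomogeneous f d}.Nonempty :=
        ⟨_, _, hel s s (Nat.le_mul_of_pos_left _ hc1), pow_ne_zero _ (hprod0 _), hhomk s⟩
      obtain ⟨g, hg, hg0, hgd⟩ := Nat.sInf_mem hne
      exact hdeg s _ g hg hg0 hgd
    have hup : ∀ s, alphaDeg (symbolicPower I s) ≤ m * (s / c + 1) := by
      intro s
      refine Nat.sInf_le ⟨_, hel s (s / c + 1) ?_, pow_ne_zero _ (hprod0 _), hhomk _⟩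
      exact (Nat.lt_mul_div_succ s hc1).le
    have hc : (0 : ℝ) < c := by exact_mod_cast hc1
    have hlim : Tendsto (fun s : ℕ => (m : ℝ) / c + m / (s : ℝ)) atTop (nhds ((m : ℝ) / c + 0)) :=
      tendsto_const_nhds.add (tendsto_const_div_atTop_nhds_zero_nat _)
    rw [add_zero] at hlim
    refine tendsto_of_tendsto_of_tendsto_of_le_of_le' tendsto_const_nhds hlim ?_ ?_
    · filter_upwards [eventually_gt_atTop 0] with s hs
      have hs' : (0 : ℝ) < s := by exact_mod_cast hs
      rw [div_le_div_iff₀ hc hs', mul_comm _ (c : ℝ)]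
      exact_mod_cast hlow s
    · filter_upwards [eventually_gt_atTop 0] with s hs
      have hs' : (0 : ℝ) < s := by exact_mod_cast hs
      have h1 : (alphaDeg (symbolicPower I s) : ℝ) ≤ m * ((s / c : ℕ) + 1) := by
        exact_mod_cast hup s
      have h2 : ((s / c : ℕ) : ℝ) ≤ s / c := Nat.cast_div_le
      have h3 : (alphaDeg (symbolicPower I s) : ℝ) ≤ m * (s / c + 1) :=
        h1.trans (by gcongr)
      rw [div_le_iff₀ hs']
      refine h3.trans (le_of_eq ?_)
      field_simp
  · have ha : alphaDeg I = m - c + 1 := by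
      obtain ⟨T, hTsub, hT⟩ := Finset.exists_subset_card_eq
        (s := (Finset.univ : Finset (Fin m))) (n := m - c + 1) (by simp; omega)
      have hmem : m - c + 1 ∈ {d | ∃ f ∈ I, f ≠ 0 ∧ MvPolynomial.IsHomogeneous f d} :=
        ⟨_, StarConf.prod_mem f T (by omega), hprod0 T, hT ▸ hhomT T⟩
      apply le_antisymm
      · exact Nat.sInf_le hmem
      · obtain ⟨g, hg, hg0, hgd⟩ := Nat.sInf_mem ⟨_, hmem⟩
        exact hdegI _ g hg hg0 hgd
    rw [ha, div_div_eq_mul_div, Nat.cast_mul, mul_comm]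
end
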